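/- arXiv:2506.13602 — 6 statements merged into one kernel-verified Lean document; each statement's English description precedes it below -/
import Mathlib

section
/- Let A be a finite-dimensional algebra and (T,F) a brick-splitting torsion pair in mod A. If X is a brick belonging to T and Y is a brick belonging to F with Hom_A(Y,X) = 0, then Ext^1_A(Y,X) = 0. -/
open Function

def IsBrick (A : Type) [Ring A] (M : ModuleCat.{0} A) : Prop :=
  Nontrivial M ∧ ∀ f : M →ₗ[A] M, f ≠ 0 → Function.Bijective f

structure TorsionPair (A : Type) [Ring A] where
  torsion : Set (ModuleCat.{0} A)
  torsionFree : Set (ModuleCat.{0} A)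
  torsion_finite : ∀ M ∈ torsion, Module.Finite A M
  torsionFree_finite : ∀ M ∈ torsionFree, Module.Finite A M
  torsion_iso : ∀ M ∈ torsion, ∀ (N : ModuleCat.{0} A), (M ≃ₗ[A] N) → N ∈ torsion
  torsionFree_iso : ∀ M ∈ torsionFree, ∀ (N : ModuleCat.{0} A), (M ≃ₗ[A] N) → N ∈ torsionFree
  inter_zero : ∀ M ∈ torsion, M ∈ torsionFree → ¬ Nontrivial M
  torsion_quot : ∀ M ∈ torsion, ∀ (N : ModuleCat.{0} A) (p : M →ₗ[A] N),
    Function.Surjective p → N ∈ torsion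
  torsionFree_sub : ∀ M ∈ torsionFree, ∀ (N : ModuleCat.{0} A) (i : N →ₗ[A] M),
    Function.Injective i → N ∈ torsionFree
  exists_torsionSub : ∀ (M : ModuleCat.{0} A), Module.Finite A M →
    ∃ t : Submodule A M, ModuleCat.of A t ∈ torsion ∧ ModuleCat.of A (M ⧸ t) ∈ torsionFree

def TorsionPair.IsBrickSplitting {A : Type} [Ring A] (P : TorsionPair A) : Prop :=
  ∀ M : ModuleCat.{0} A, Module.Finite A M → IsBrick A M →
    M ∈ P.torsion ∨ M ∈ P.torsionFree

theorem stmt0 (k A : Type) [Field k] [Ring A] [Algebra k A] [FiniteDimensional k A]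
    (P : TorsionPair A) (hP : P.IsBrickSplitting)
    (X Y : ModuleCat.{0} A)
    (hX : IsBrick A X) (hXT : X ∈ P.torsion)
    (hY : IsBrick A Y) (hYF : Y ∈ P.torsionFree)
    (hhom : ∀ f : Y →ₗ[A] X, f = 0) :
    ∀ (E : ModuleCat.{0} A) (i : X →ₗ[A] E) (p : E →ₗ[A] Y),
      Function.Injective i → Function.Surjective p → Function.Exact i p →
      ∃ s : Y →ₗ[A] E, p ∘ₗ s = LinearMap.id := by
  intro E i p hi hp hip
  have hpi : ∀ x, p (i x) = 0 := fun x => (hip (i x)).2 ⟨x, rfl⟩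
  -- Hom(X, Y) = 0
  have hXY : ∀ f : X →ₗ[A] Y, f = 0 := by
    intro f
    have h1 := P.torsion_quot X hXT (ModuleCat.of A (LinearMap.range f)) f.rangeRestrict
      f.surjective_rangeRestrict
    have h2 := P.torsionFree_sub Y hYF (ModuleCat.of A (LinearMap.range f))
      (LinearMap.range f).subtype (Submodule.injective_subtype _)
    have h3 := P.inter_zero _ h1 h2
    have h4 : Subsingleton (LinearMap.range f) := not_nontrivial_iff_subsingleton.1 h3
    have h5 := (Submodule.subsingleton_iff_eq_bot).1 h4
    exact LinearMap.range_eq_bot.1 h5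
  -- a map that vanishes on X factors through Y
  have lift : ∀ (M : ModuleCat.{0} A) (f : E →ₗ[A] M), (∀ x, f (i x) = 0) →
      ∃ g : Y →ₗ[A] M, ∀ e, g (p e) = f e := by
    intro M f hf
    have hker : LinearMap.ker p ≤ LinearMap.ker f := by
      intro e he
      obtain ⟨x, rfl⟩ := (hip e).1 he
      exact hf x
    let q := p.quotKerEquivOfSurjective hp
    refine ⟨((LinearMap.ker p).liftQ f hker) ∘ₗ q.symm.toLinearMap, fun e => ?_⟩
    have : q.symm (p e) = (LinearMap.ker p).mkQ e := by
      rw [LinearEquiv.symm_apply_eq]; rfl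
    simp [this]
  -- a map with image in ker p factors through X
  have colift : ∀ (M : ModuleCat.{0} A) (f : M →ₗ[A] E), (∀ x, p (f x) = 0) →
      ∃ g : M →ₗ[A] X, ∀ m, i (g m) = f m := by
    intro M f hf
    let q := LinearEquiv.ofInjective i hi
    refine ⟨q.symm.toLinearMap ∘ₗ f.codRestrict (LinearMap.range i)
      (fun m => (hip (f m)).1 (hf m)), fun m => ?_⟩
    exact congrArg Subtype.val (q.apply_symm_apply
      (f.codRestrict (LinearMap.range i) (fun m => (hip (f m)).1 (hf m)) m))
  by_contra hns
  have hbrick : IsBrick A E := by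
    have := hY.1
    refine ⟨hp.nontrivial, fun f hf => ?_⟩
    have hz : ∀ x, p (f (i x)) = 0 := fun x => LinearMap.congr_fun (hXY (p ∘ₗ f ∘ₗ i)) x
    obtain ⟨g, hg⟩ := colift X (f ∘ₗ i) hz
    obtain ⟨h, hh⟩ := lift Y (p ∘ₗ f) hz
    simp only [LinearMap.comp_apply] at hg hh
    by_cases g0 : g = 0
    · subst g0
      obtain ⟨s, hs⟩ := lift E f (fun x => by rw [← hg]; simp)
      by_cases h0 : h = 0
      · subst h0
        obtain ⟨r, hr⟩ := colift Y s (fun y => by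
          obtain ⟨e, rfl⟩ := hp y
          rw [hs, ← hh]; simp)
        exfalso
        apply hf
        ext e
        rw [← hs, ← hr, hhom r]; simp
      · exfalso
        let H := LinearEquiv.ofBijective h (hY.2 h h0)
        apply hns
        refine ⟨s ∘ₗ H.symm.toLinearMap, ?_⟩
        ext y
        obtain ⟨z, rfl⟩ := H.surjective y
        obtain ⟨e, rfl⟩ := hp z
        change p (s (H.symm (H (p e)))) = h (p e)
        rw [H.symm_apply_apply, hs, hh]
    · have gb := hX.2 g g0
      by_cases h0 : h = 0
      · subst h0
        exfalso
        obtain ⟨r, hr⟩ := colift E f (fun e => by rw [← hh]; simp)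
        let G := LinearEquiv.ofBijective g gb
        have hrg : ∀ x, r (i x) = g x := fun x => hi (by rw [hr, hg])
        have hGg : ∀ x, G.symm (g x) = x := fun x => G.symm_apply_apply x
        obtain ⟨s, hs⟩ := lift E (LinearMap.id - i ∘ₗ G.symm.toLinearMap ∘ₗ r) (fun x => by
          simp [hrg, hGg])
        apply hns
        refine ⟨s, ?_⟩
        ext y
        obtain ⟨e, rfl⟩ := hp y
        simp [hs, hpi]
      · have hb := hY.2 h h0
        constructor
        · rw [injective_iff_map_eq_zero]
          intro e he
          have h1 : p e = 0 := hb.1 (by rw [hh, he]; simp)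
          obtain ⟨x, rfl⟩ := (hip e).1 h1
          have h2 : g x = 0 := hi (by rw [hg, he]; simp)
          have h3 : x = 0 := gb.1 (by rw [h2]; simp)
          rw [h3]; simp
        · intro e
          obtain ⟨y, hy⟩ := hb.2 (p e)
          obtain ⟨e', rfl⟩ := hp y
          obtain ⟨x, hx⟩ := (hip (e - f e')).1 (by rw [map_sub, ← hh, hy, sub_self])
          obtain ⟨x', rfl⟩ := gb.2 x
          refine ⟨e' + i x', ?_⟩
          rw [map_add, ← hg, hx]; abel
  have hfin : Module.Finite A E := by
    have := P.torsion_finite X hXT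
    have := P.torsionFree_finite Y hYF
    have h1 : Module.Finite A (LinearMap.ker p) := by
      rw [LinearMap.exact_iff.1 hip]
      infer_instance
    have h2 : Module.Finite A (E ⧸ LinearMap.ker p) :=
      Module.Finite.equiv (p.quotKerEquivOfSurjective hp).symm
    exact Module.Finite.of_submodule_quotient (LinearMap.ker p)
  rcases hP E hfin hbrick with hE | hE
  · exact P.inter_zero Y (P.torsion_quot E hE Y p hp) hYF hY.1
  · exact P.inter_zero X hXT (P.torsionFree_sub E hE X i hi) hX.1
end

section
/- Let A be a finite-dimensional hereditary algebra (global dimension at most 1) and (T,F) a functorially finite torsion pair in mod A. Then (T,F) is splitting if and only if it is brick-splitting. -/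
open Function

def IsIndecomposableModule (A : Type) [Ring A] (M : ModuleCat.{0} A) : Prop :=
  Nontrivial M ∧ ∀ (N₁ N₂ : Submodule A M), IsCompl N₁ N₂ → N₁ = ⊥ ∨ N₂ = ⊥

/-- A ring is (left) hereditary if submodules of projective modules are projective;
for a finite-dimensional algebra this is equivalent to global dimension at most 1. -/
def IsHereditaryRing (A : Type) [Ring A] : Prop :=
  ∀ (M : ModuleCat.{0} A) (N : Submodule A M), Module.Projective A M → Module.Projective A N

def TorsionPair.IsSplitting {A : Type} [Ring A] (P : TorsionPair A) : Prop :=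
  ∀ M : ModuleCat.{0} A, Module.Finite A M → IsIndecomposableModule A M →
    M ∈ P.torsion ∨ M ∈ P.torsionFree

/-- A torsion pair is functorially finite if every finitely generated module admits
a right `T`-approximation and a left `T`-approximation. -/
def TorsionPair.IsFunctoriallyFinite {A : Type} [Ring A] (P : TorsionPair A) : Prop :=
  (∀ M : ModuleCat.{0} A, Module.Finite A M →
    ∃ (T₀ : ModuleCat.{0} A) (_ : T₀ ∈ P.torsion) (f : T₀ →ₗ[A] M),
      ∀ T' : ModuleCat.{0} A, T' ∈ P.torsion →
        ∀ g : T' →ₗ[A] M, ∃ h : T' →ₗ[A] T₀, f ∘ₗ h = g) ∧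
  (∀ M : ModuleCat.{0} A, Module.Finite A M →
    ∃ (T₀ : ModuleCat.{0} A) (_ : T₀ ∈ P.torsion) (f : M →ₗ[A] T₀),
      ∀ T' : ModuleCat.{0} A, T' ∈ P.torsion →
        ∀ g : M →ₗ[A] T', ∃ h : T₀ →ₗ[A] T', h ∘ₗ f = g)

section Helpers

variable {A : Type} [Ring A]

theorem hlp_desc {P X Y : Type} [AddCommGroup P] [Module A P] [AddCommGroup X] [Module A X]
    [AddCommGroup Y] [Module A Y] (π : P →ₗ[A] X) (hπ : Surjective π) (φ : P →ₗ[A] Y)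
    (h : ∀ x, π x = 0 → φ x = 0) : ∃ ψ : X →ₗ[A] Y, ∀ x, ψ (π x) = φ x := by
  refine ⟨((LinearMap.ker π).liftQ φ (fun x hx => h x hx)) ∘ₗ
    (π.quotKerEquivOfSurjective hπ).symm.toLinearMap, fun x => ?_⟩
  have : (π.quotKerEquivOfSurjective hπ).symm (π x) = (LinearMap.ker π).mkQ x := by
    rw [LinearEquiv.symm_apply_eq]; rfl
  rw [LinearMap.comp_apply, LinearEquiv.coe_coe, this]
  exact Submodule.liftQ_apply _ _ _

theorem hlp_lift {P E Y : Type} [AddCommGroup P] [Module A P] [AddCommGroup E] [Module A E]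
    [AddCommGroup Y] [Module A Y] (i : Y →ₗ[A] E) (hi : Injective i) (φ : P →ₗ[A] E)
    (h : ∀ x, ∃ y, i y = φ x) : ∃ ψ : P →ₗ[A] Y, ∀ x, i (ψ x) = φ x := by
  refine ⟨(LinearEquiv.ofInjective i hi).symm.toLinearMap ∘ₗ
    φ.codRestrict (LinearMap.range i) (fun x => h x), fun x => ?_⟩
  have := (LinearEquiv.ofInjective i hi).apply_symm_apply
    (φ.codRestrict (LinearMap.range i) (fun x => h x) x)
  exact congrArg Subtype.val this

/-- Vanishing of `Ext^1(X, Y)` expressed through projective presentations of `X`. -/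
def ExtV (A : Type) [Ring A] (X Y : Type) [AddCommGroup X] [Module A X]
    [AddCommGroup Y] [Module A Y] : Prop :=
  ∀ (P : Type) [AddCommGroup P] [Module A P], Module.Projective A P →
    ∀ π : P →ₗ[A] X, Surjective π → ∀ g : LinearMap.ker π →ₗ[A] Y,
      ∃ h : P →ₗ[A] Y, ∀ x : LinearMap.ker π, h x = g x

variable {X Y : Type} [AddCommGroup X] [Module A X] [AddCommGroup Y] [Module A Y]

theorem extV_of_one {Q : Type} [AddCommGroup Q] [Module A Q] [Module.Projective A Q]
    (ρ : Q →ₗ[A] X) (hρ : Surjective ρ)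
    (H : ∀ g : LinearMap.ker ρ →ₗ[A] Y, ∃ h : Q →ₗ[A] Y, ∀ x : LinearMap.ker ρ, h x = g x) :
    ExtV A X Y := by
  intro P _ _ hP π hπ g
  obtain ⟨a, ha⟩ := Module.projective_lifting_property π ρ hπ
  obtain ⟨b, hb⟩ := Module.projective_lifting_property ρ π hρ
  have ha' : ∀ x, π (a x) = ρ x := fun x => LinearMap.congr_fun ha x
  have hb' : ∀ x, ρ (b x) = π x := fun x => LinearMap.congr_fun hb x
  obtain ⟨a1, ha1⟩ := hlp_lift (LinearMap.ker π).subtype Subtype.val_injective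
    (a ∘ₗ (LinearMap.ker ρ).subtype) (fun x => ⟨⟨a x, by
      have := x.2
      simpa [ha'] using this⟩, rfl⟩)
  obtain ⟨h, hh⟩ := H (g ∘ₗ a1)
  obtain ⟨c, hc⟩ := hlp_lift (LinearMap.ker π).subtype Subtype.val_injective
    (LinearMap.id - a ∘ₗ b) (fun x => ⟨⟨x - a (b x), by simp [ha', hb']⟩, rfl⟩)
  refine ⟨h ∘ₗ b + g ∘ₗ c, fun x => ?_⟩
  have hbx : b x ∈ LinearMap.ker ρ := by
    have := x.2
    simpa [hb'] using this
  have h1 : h (b x) = g (a1 ⟨b x, hbx⟩) := hh ⟨b x, hbx⟩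
  have h2 : a1 ⟨b x, hbx⟩ + c x = x := by
    apply Subtype.val_injective
    have e1 := ha1 ⟨b x, hbx⟩
    have e2 := hc x
    simp only [Submodule.subtype_apply, LinearMap.comp_apply, LinearMap.sub_apply,
      LinearMap.id_apply] at e1 e2
    rw [Submodule.coe_add, e1, e2]; abel
  simp only [LinearMap.add_apply, LinearMap.comp_apply]
  rw [h1, ← map_add, h2]

theorem exists_pres (A : Type) [Ring A] (X : Type) [AddCommGroup X] [Module A X] :
    ∃ (P : Type) (_ : AddCommGroup P) (_ : Module A P) (_ : Module.Projective A P)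
      (π : P →ₗ[A] X), Surjective π :=
  ⟨X →₀ A, inferInstance, inferInstance, inferInstance, Finsupp.linearCombination A id, Finsupp.linearCombination_id_surjective A X⟩

theorem her_sub (hher : IsHereditaryRing A) {P : Type} [AddCommGroup P] [Module A P]
    (hP : Module.Projective A P) (N : Submodule A P) : Module.Projective A N :=
  hher (ModuleCat.of A P) N hP

theorem ExtV.quot (hher : IsHereditaryRing A) (H : ExtV A X Y) {Z : Type} [AddCommGroup Z]
    [Module A Z] (q : Y →ₗ[A] Z) (hq : Surjective q) : ExtV A X Z := by
  intro P _ _ hP π hπ g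
  have := her_sub hher hP (LinearMap.ker π)
  obtain ⟨g', hg'⟩ := Module.projective_lifting_property q g hq
  obtain ⟨h, hh⟩ := H P hP π hπ g'
  exact ⟨q ∘ₗ h, fun x => by
    rw [LinearMap.comp_apply, hh x]; exact LinearMap.congr_fun hg' x⟩

theorem ExtV.sub (hher : IsHereditaryRing A) (H : ExtV A X Y) {Z : Type} [AddCommGroup Z]
    [Module A Z] (j : Z →ₗ[A] X) (hj : Injective j) : ExtV A Z Y := by
  obtain ⟨P, _, _, hP, π, hπ⟩ := exists_pres A X
  let P' : Submodule A P := (LinearMap.range j).comap π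
  have hP' := her_sub hher hP P'
  obtain ⟨ρ, hρ⟩ := hlp_lift j hj (π ∘ₗ P'.subtype) (fun x => x.2)
  have hρ' : ∀ x : P', j (ρ x) = π x := hρ
  refine extV_of_one ρ ?_ ?_
  · intro z
    obtain ⟨p, hp⟩ := hπ (j z)
    exact ⟨⟨p, z, hp.symm⟩, hj (by rw [hρ', hp])⟩
  · intro g
    have hmem : ∀ x : LinearMap.ker π, (x : P) ∈ P' := fun x =>
      ⟨0, by rw [map_zero]; exact x.2.symm⟩
    obtain ⟨c, hc⟩ := hlp_lift (P'.subtype ∘ₗ (LinearMap.ker ρ).subtype)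
      (Subtype.val_injective.comp Subtype.val_injective) (LinearMap.ker π).subtype
      (fun x => ⟨⟨⟨x, hmem x⟩, hj (by rw [hρ', map_zero]; exact x.2)⟩, rfl⟩)
    obtain ⟨h, hh⟩ := H _ inferInstance π hπ (g ∘ₗ c)
    refine ⟨h ∘ₗ P'.subtype, fun x => ?_⟩
    have hx : ((x : P') : P) ∈ LinearMap.ker π := by
      have h1 : ρ x = 0 := x.2
      have h2 := hρ' x
      rw [h1, map_zero] at h2
      exact h2.symm
    have h1 := hh ⟨_, hx⟩
    have h2 : c ⟨_, hx⟩ = x := by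
      apply Subtype.val_injective
      apply Subtype.val_injective
      exact hc ⟨_, hx⟩
    rw [LinearMap.comp_apply, h2] at h1
    exact h1

/-- `Ext^1(-, Y)` is half exact (kernel and range of a map). -/
theorem ExtV.mid (hher : IsHereditaryRing A) {Z : Type} [AddCommGroup Z] [Module A Z]
    (f : X →ₗ[A] Z) (hk : ExtV A (LinearMap.ker f) Y) (hr : ExtV A (LinearMap.range f) Y) :
    ExtV A X Y := by
  intro P _ _ hP π hπ g
  let f' : P →ₗ[A] LinearMap.range f := f.rangeRestrict ∘ₗ π
  have hf' : Surjective f' := f.surjective_rangeRestrict.comp hπ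
  have hP' := her_sub hher hP (LinearMap.ker f')
  have hmem : ∀ x : P, x ∈ LinearMap.ker f' ↔ f (π x) = 0 := fun x => by
    rw [LinearMap.mem_ker, ← Subtype.val_injective.eq_iff]; rfl
  obtain ⟨ρ, hρ⟩ := hlp_lift (LinearMap.ker f).subtype Subtype.val_injective
    (π ∘ₗ (LinearMap.ker f').subtype) (fun x => ⟨⟨π x, (hmem _).1 x.2⟩, rfl⟩)
  have hρ' : ∀ x : LinearMap.ker f', (ρ x : X) = π x := hρ
  have hρs : Surjective ρ := by
    intro z
    obtain ⟨p, hp⟩ := hπ z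
    exact ⟨⟨p, (hmem p).2 (by rw [hp]; exact z.2)⟩, Subtype.val_injective (by rw [hρ', hp])⟩
  obtain ⟨c, hc⟩ := hlp_lift (LinearMap.ker π).subtype Subtype.val_injective
    ((LinearMap.ker f').subtype ∘ₗ (LinearMap.ker ρ).subtype)
    (fun x => ⟨⟨x, by
      have h1 : ρ x = 0 := x.2
      have h2 := hρ' x
      rw [h1] at h2
      exact h2.symm⟩, rfl⟩)
  obtain ⟨h1, hh1⟩ := hk _ hP' ρ hρs (g ∘ₗ c)
  obtain ⟨h, hh⟩ := hr _ hP f' hf' h1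
  refine ⟨h, fun x => ?_⟩
  have hx0 : π x = 0 := x.2
  have hx : (x : P) ∈ LinearMap.ker f' := (hmem _).2 (by rw [hx0, map_zero])
  have hx' : (⟨x, hx⟩ : LinearMap.ker f') ∈ LinearMap.ker ρ :=
    Subtype.val_injective (by rw [hρ']; exact hx0)
  have e1 := hh ⟨x, hx⟩
  have e2 := hh1 ⟨_, hx'⟩
  have e3 : c ⟨_, hx'⟩ = x := Subtype.val_injective (hc ⟨_, hx'⟩)
  rw [LinearMap.comp_apply, e3] at e2
  exact e1.trans e2

theorem ExtV.pi {n : Type} (H : ExtV A X Y) : ExtV A X (n → Y) := by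
  intro P _ _ hP π hπ g
  choose h hh using fun i : n => H P hP π hπ (LinearMap.proj i ∘ₗ g)
  exact ⟨LinearMap.pi h, fun x => funext fun i => hh i x⟩

theorem ExtV.compl {N₁ N₂ : Submodule A Y} (hc : IsCompl N₁ N₂) (h1 : ExtV A X N₁)
    (h2 : ExtV A X N₂) : ExtV A X Y := by
  intro P _ _ hP π hπ g
  let e := Submodule.prodEquivOfIsCompl N₁ N₂ hc
  obtain ⟨u, hu⟩ := h1 P hP π hπ (LinearMap.fst A _ _ ∘ₗ e.symm.toLinearMap ∘ₗ g)
  obtain ⟨v, hv⟩ := h2 P hP π hπ (LinearMap.snd A _ _ ∘ₗ e.symm.toLinearMap ∘ₗ g)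
  refine ⟨e.toLinearMap ∘ₗ u.prod v, fun x => ?_⟩
  have : u.prod v x = e.symm (g x) := Prod.ext (hu x) (hv x)
  simp only [LinearMap.comp_apply, this, LinearEquiv.coe_coe, LinearEquiv.apply_symm_apply]

theorem extV_of_subsingleton_left [Subsingleton X] : ExtV A X Y := by
  intro P _ _ hP π hπ g
  obtain ⟨c, hc⟩ := hlp_lift (LinearMap.ker π).subtype Subtype.val_injective
    LinearMap.id (fun x => ⟨⟨x, Subsingleton.elim _ _⟩, rfl⟩)
  refine ⟨g ∘ₗ c, fun x => ?_⟩
  rw [LinearMap.comp_apply, show c x = x from Subtype.val_injective (hc x)]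

theorem extV_of_subsingleton_right [Subsingleton Y] : ExtV A X Y := by
  intro P _ _ hP π hπ g
  exact ⟨0, fun x => Subsingleton.elim _ _⟩

theorem ExtV.split (H : ExtV A X Y) {E : Type} [AddCommGroup E] [Module A E]
    (i : Y →ₗ[A] E) (hi : Injective i) (p : E →ₗ[A] X) (hp : Surjective p)
    (hex : ∀ e, p e = 0 → ∃ y, i y = e) (hpi : ∀ y, p (i y) = 0) :
    ∃ s : X →ₗ[A] E, ∀ x, p (s x) = x := by
  obtain ⟨P, _, _, hP, π, hπ⟩ := exists_pres A X
  obtain ⟨ψ, hψ⟩ := Module.projective_lifting_property p π hp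
  have hψ' : ∀ x, p (ψ x) = π x := fun x => LinearMap.congr_fun hψ x
  obtain ⟨g, hg⟩ := hlp_lift i hi (ψ ∘ₗ (LinearMap.ker π).subtype)
    (fun x => hex _ (by rw [LinearMap.comp_apply, hψ']; exact x.2))
  obtain ⟨h, hh⟩ := H _ inferInstance π hπ g
  obtain ⟨s, hs⟩ := hlp_desc π hπ (ψ - i ∘ₗ h) (fun x hx => by
    have e1 := hh ⟨x, hx⟩
    have e2 := hg ⟨x, hx⟩
    simp only [LinearMap.sub_apply, LinearMap.comp_apply] at e1 e2 ⊢
    rw [e1, e2]; simp)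
  refine ⟨s, fun x => ?_⟩
  obtain ⟨y, rfl⟩ := hπ x
  rw [hs]; simp [hψ', hpi]

/-- If all extensions split then `Ext^1` vanishes. -/
theorem extV_of_split (H : ∀ (E : Type) [AddCommGroup E] [Module A E]
    (i : Y →ₗ[A] E) (p : E →ₗ[A] X), Injective i → Surjective p →
    (∀ e, p e = 0 → ∃ y, i y = e) → (∀ y, p (i y) = 0) →
    ∃ r : E →ₗ[A] Y, ∀ y, r (i y) = y) : ExtV A X Y := by
  intro P _ _ hP π hπ g
  let j : LinearMap.ker π →ₗ[A] Y × P := (-g).prod (LinearMap.ker π).subtype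
  let R := LinearMap.range j
  have hRk : ∀ z : Y × P, (LinearMap.range j).mkQ z = 0 ↔ ∃ k, j k = z := fun z => by
    rw [Submodule.mkQ_apply, Submodule.Quotient.mk_eq_zero]; rfl
  obtain ⟨p, hp⟩ := hlp_desc R.mkQ R.mkQ_surjective (π ∘ₗ LinearMap.snd A Y P) (fun z hz => by
    obtain ⟨k, rfl⟩ := (hRk z).1 hz
    exact k.2)
  have hp' : ∀ z, p (R.mkQ z) = π z.2 := hp
  obtain ⟨r, hr⟩ := H ((Y × P) ⧸ R) (R.mkQ ∘ₗ LinearMap.inl A Y P) p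
    (by
      rw [← LinearMap.ker_eq_bot, LinearMap.ker_eq_bot']
      intro y hy
      obtain ⟨k, hk⟩ := (hRk _).1 hy
      have h2 : (k : P) = 0 := congrArg Prod.snd hk
      have h1 : -g k = y := congrArg Prod.fst hk
      rw [← h1, show k = 0 from Subtype.val_injective h2, map_zero, neg_zero])
    (fun x => by
      obtain ⟨q, rfl⟩ := hπ x
      exact ⟨R.mkQ (0, q), hp' _⟩)
    (fun e he => by
      obtain ⟨⟨y, q⟩, rfl⟩ := R.mkQ_surjective e
      rw [hp'] at he
      refine ⟨y + g ⟨q, he⟩, ?_⟩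
      rw [LinearMap.comp_apply, ← sub_eq_zero, ← map_sub]
      refine (hRk _).2 ⟨-⟨q, he⟩, ?_⟩
      ext <;> simp [j])
    (fun y => by rw [LinearMap.comp_apply, hp']; simp)
  refine ⟨r ∘ₗ R.mkQ ∘ₗ LinearMap.inr A Y P, fun x => ?_⟩
  have h1 : R.mkQ (LinearMap.inr A Y P x) = R.mkQ (LinearMap.inl A Y P (g x)) := by
    rw [← sub_eq_zero, ← map_sub]
    refine (hRk _).2 ⟨x, ?_⟩
    ext <;> simp [j]
  rw [LinearMap.comp_apply, LinearMap.comp_apply, h1]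
  exact hr _

/-- Fitting's lemma for indecomposable modules. -/
theorem fitting {T : Type} [AddCommGroup T] [Module A T] [IsArtinian A T] [IsNoetherian A T]
    (hT : ∀ (N₁ N₂ : Submodule A T), IsCompl N₁ N₂ → N₁ = ⊥ ∨ N₂ = ⊥) (f : Module.End A T) :
    Bijective f ∨ IsNilpotent f := by
  obtain ⟨n, hn⟩ := Filter.eventually_atTop.1 f.eventually_isCompl_ker_pow_range_pow
  have h := hn (n + 1) (Nat.le_succ n)
  rcases hT _ _ h with h | h
  · left
    apply IsArtinian.bijective_of_injective_endomorphism
    rw [LinearMap.ker_eq_bot, pow_succ] at h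
    exact Injective.of_comp (f := ⇑(f ^ n)) (by simpa [Module.End.mul_eq_comp] using h)
  · right
    exact ⟨n + 1, LinearMap.range_eq_bot.1 h⟩

/-- Happel-Ringel: indecomposable rigid modules over hereditary algebras are bricks. -/
theorem rigid_brick (hher : IsHereditaryRing A) {T : Type} [AddCommGroup T] [Module A T]
    [IsArtinian A T] [IsNoetherian A T] (hr : ExtV A T T)
    (hT : ∀ (N₁ N₂ : Submodule A T), IsCompl N₁ N₂ → N₁ = ⊥ ∨ N₂ = ⊥)
    (f : T →ₗ[A] T) (hf : f ≠ 0) : Bijective f := by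
  obtain ⟨P, _, _, hP, ρ, hρ⟩ := exists_pres A T
  let I := LinearMap.range f
  let F : T →ₗ[A] I := f.rangeRestrict
  have hF : Surjective F := f.surjective_rangeRestrict
  let QI := I.comap ρ
  have hQI := her_sub hher hP QI
  let ρI : QI →ₗ[A] I := ρ.restrict (fun x hx => hx)
  have hρI : Surjective ρI := by
    rintro ⟨x, hx⟩
    obtain ⟨q, rfl⟩ := hρ x
    exact ⟨⟨q, hx⟩, rfl⟩
  obtain ⟨l, hl⟩ := Module.projective_lifting_property F ρI hF
  have hl' : ∀ x, F (l x) = ρI x := fun x => LinearMap.congr_fun hl x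
  have hmem : ∀ x, ρ x = 0 → x ∈ QI := fun x hx => by
    change ρ x ∈ I
    rw [hx]; exact I.zero_mem
  obtain ⟨c, hc⟩ := hlp_lift QI.subtype Subtype.val_injective (LinearMap.ker ρ).subtype
    (fun x => ⟨⟨x, hmem _ x.2⟩, rfl⟩)
  obtain ⟨μ, hμ⟩ := hr _ inferInstance ρ hρ (l ∘ₗ c)
  have hμ' : ∀ (x) (hx : ρ x = 0), μ x = l ⟨x, hmem x hx⟩ := fun x hx => by
    have h1 := hμ ⟨x, hx⟩
    rw [LinearMap.comp_apply,
      show c ⟨x, hx⟩ = ⟨x, hmem x hx⟩ from Subtype.val_injective (hc _)] at h1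
    exact h1
  obtain ⟨r, hr⟩ := hlp_desc ρI hρI (l - μ ∘ₗ QI.subtype) (fun x hx => by
    have hx' : ρ x = 0 := congrArg Subtype.val hx
    have := hμ' x hx'
    simp [this])
  obtain ⟨α, hα⟩ := hlp_desc ρ hρ (F ∘ₗ μ) (fun x hx => by
    rw [LinearMap.comp_apply, hμ' x hx, hl']
    exact Subtype.val_injective hx)
  have key : ∀ y : I, F (r y) + α y = y := by
    intro y
    obtain ⟨q, rfl⟩ := hρI y
    have h1 := hα q
    rw [hr]
    have h2 : ((ρI q : I) : T) = ρ q := rfl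
    rw [h2, h1]
    simp [hl']
  have hI : Nontrivial I := by
    rw [Submodule.nontrivial_iff_ne_bot]
    exact fun h => hf (LinearMap.range_eq_bot.1 h)
  rcases fitting hT (I.subtype ∘ₗ α) with ha | ⟨n, hn⟩
  · have : Surjective f := fun x => by
      obtain ⟨y, hy⟩ := ha.2 x
      rw [← hy]
      exact (α y).2
    exact ⟨(IsNoetherian.injective_of_surjective_endomorphism f this), this⟩
  rcases fitting hT (r ∘ₗ F) with hb | ⟨m, hm⟩
  · apply IsArtinian.bijective_of_injective_endomorphism
    have : Injective F := Injective.of_comp (f := r) hb.1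
    exact fun x y h => this (Subtype.val_injective h)
  exfalso
  let u : Module.End A I := α ∘ₗ I.subtype
  let v : Module.End A I := F ∘ₗ r
  have huv : v + u = 1 := LinearMap.ext key
  have hu : IsNilpotent u := by
    refine ⟨n + 1, ?_⟩
    have : ∀ n, u ^ (n + 1) = α ∘ₗ ((I.subtype ∘ₗ α : Module.End A T) ^ n) ∘ₗ I.subtype := by
      intro n
      induction n with
      | zero => ext; simp [u]
      | succ n ih => rw [pow_succ', ih, pow_succ']; rfl
    rw [this, hn]; ext; simp
  have hv : IsNilpotent v := by
    refine ⟨m + 1, ?_⟩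
    have : ∀ n, v ^ (n + 1) = F ∘ₗ ((r ∘ₗ F : Module.End A T) ^ n) ∘ₗ r := by
      intro n
      induction n with
      | zero => ext; simp [v]
      | succ n ih => rw [pow_succ', ih, pow_succ']; rfl
    rw [this, hm]; ext; simp
  have h1 : IsUnit v := by
    rw [eq_sub_of_add_eq huv]; exact hu.isUnit_one_sub
  exact hv.not_isUnit h1

end Helpers

section Torsion

variable {A : Type} [Ring A] (P : TorsionPair A)

/-- unbundled membership in the torsion class -/
def Tor (M : Type) [AddCommGroup M] [Module A M] : Prop := ModuleCat.of A M ∈ P.torsion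

/-- unbundled membership in the torsion-free class -/
def Fre (M : Type) [AddCommGroup M] [Module A M] : Prop := ModuleCat.of A M ∈ P.torsionFree

variable {P}
variable {M N : Type} [AddCommGroup M] [Module A M] [AddCommGroup N] [Module A N]

theorem Tor.quot (h : Tor P M) (p : M →ₗ[A] N) (hp : Surjective p) : Tor P N :=
  P.torsion_quot _ h (ModuleCat.of A N) p hp

theorem Fre.sub (h : Fre P M) (i : N →ₗ[A] M) (hi : Injective i) : Fre P N :=
  P.torsionFree_sub _ h (ModuleCat.of A N) i hi

theorem tor_fre (h : Tor P M) (h' : Fre P M) : Subsingleton M :=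
  not_nontrivial_iff_subsingleton.1 (P.inter_zero _ h h')

theorem tor_fre_hom (h : Tor P M) (h' : Fre P N) (f : M →ₗ[A] N) (x : M) : f x = 0 := by
  have h1 : Tor P (LinearMap.range f) := h.quot f.rangeRestrict f.surjective_rangeRestrict
  have h2 : Fre P (LinearMap.range f) := h'.sub (LinearMap.range f).subtype
    Subtype.val_injective
  have := tor_fre h1 h2
  exact congrArg Subtype.val (Subsingleton.elim (⟨f x, x, rfl⟩ : LinearMap.range f) 0)

theorem exists_tor (P : TorsionPair A) (M : Type) [AddCommGroup M] [Module A M]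
    [h : Module.Finite A M] : ∃ t : Submodule A M, Tor P t ∧ Fre P (M ⧸ t) :=
  P.exists_torsionSub (ModuleCat.of A M) h

theorem tor_ext {E : Type} [AddCommGroup E] [Module A E] [Module.Finite A E]
    (hM : Tor P M) (hN : Tor P N) (i : M →ₗ[A] E) (p : E →ₗ[A] N) (hp : Surjective p)
    (hex : ∀ e, p e = 0 → ∃ y, i y = e) : Tor P E := by
  obtain ⟨t, ht, hf⟩ := exists_tor P E
  obtain ⟨q, hq⟩ := hlp_desc p hp t.mkQ (fun e he => by
    obtain ⟨y, rfl⟩ := hex e he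
    exact tor_fre_hom hM hf (t.mkQ ∘ₗ i) y)
  refine ht.quot t.subtype (fun e => ?_)
  have h1 : t.mkQ e = 0 := by rw [← hq]; exact tor_fre_hom hN hf q _
  rw [Submodule.mkQ_apply, Submodule.Quotient.mk_eq_zero] at h1
  exact ⟨⟨e, h1⟩, rfl⟩

theorem finite_ext {E : Type} [AddCommGroup E] [Module A E] [Module.Finite A M]
    [Module.Finite A N] (i : M →ₗ[A] E) (p : E →ₗ[A] N) (hp : Surjective p)
    (hex : ∀ e, p e = 0 → ∃ y, i y = e) (hpi : ∀ y, p (i y) = 0) : Module.Finite A E := by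
  have h1 : Module.Finite A (LinearMap.ker p) :=
    Module.Finite.of_surjective (i.codRestrict (LinearMap.ker p) hpi) (fun ⟨e, he⟩ => by
      obtain ⟨y, hy⟩ := hex e he
      exact ⟨y, Subtype.val_injective hy⟩)
  have h2 : Module.Finite A (E ⧸ LinearMap.ker p) :=
    Module.Finite.equiv (p.quotKerEquivOfSurjective hp).symm
  exact Module.Finite.of_submodule_quotient (LinearMap.ker p)

theorem Tor.fin (h : Tor P M) : Module.Finite A M := P.torsion_finite _ h
theorem Fre.fin (h : Fre P M) : Module.Finite A M := P.torsionFree_finite _ h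

/-- The Ext-projective generator of the torsion class. -/
theorem exists_gen [IsArtinianRing A] (hff : P.IsFunctoriallyFinite) :
    ∃ T₀ : ModuleCat.{0} A, Tor P T₀ ∧ (∀ T : ModuleCat.{0} A, Tor P T → ExtV A T₀ T) ∧
      ∀ T : ModuleCat.{0} A, Tor P T → ∃ (n : Type) (q : (n → T₀) →ₗ[A] T), Surjective q := by
  let S : Set (ModuleCat.{0} A) := {T₀ | Tor P T₀ ∧ ∃ f : A →ₗ[A] T₀,
    ∀ T' : ModuleCat.{0} A, Tor P T' → ∀ g : A →ₗ[A] T', ∃ h : T₀ →ₗ[A] T', h ∘ₗ f = g}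
  have hS : S.Nonempty := by
    obtain ⟨T₀, h, f, hf⟩ := hff.2 (ModuleCat.of A A) (inferInstanceAs (Module.Finite A A))
    exact ⟨T₀, h, f, hf⟩
  obtain ⟨T₀, ⟨hT, φ, hφ⟩, hmin⟩ := WellFounded.has_min
    (InvImage.wf (fun T : ModuleCat.{0} A => Module.length A T) (wellFounded_lt (α := ℕ∞))) S hS
  have hfin : Module.Finite A T₀ := hT.fin
  have hsurj : ∀ g : T₀ →ₗ[A] T₀, (∀ a, g (φ a) = φ a) → Surjective g := by
    intro g hg
    by_contra hns
    refine hmin (ModuleCat.of A (LinearMap.range g)) ⟨hT.quot g.rangeRestrict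
      g.surjective_rangeRestrict, φ.codRestrict _ (fun a => ⟨φ a, hg a⟩), fun T' hT' u => ?_⟩ ?_
    · obtain ⟨h, hh⟩ := hφ T' hT' u
      exact ⟨h ∘ₗ (LinearMap.range g).subtype, by rw [← hh]; rfl⟩
    · exact Submodule.length_lt (fun h => hns (LinearMap.range_eq_top.1 h))
  refine ⟨T₀, hT, fun T hT1 => ?_, fun T hT1 => ?_⟩
  · apply extV_of_split
    intro E _ _ i p hi hp hex hpi
    have := hT1.fin
    have hE := finite_ext i p hp hex hpi
    have hET : Tor P E := tor_ext hT1 hT i p hp hex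
    obtain ⟨ψ, hψ⟩ := Module.projective_lifting_property p φ hp
    obtain ⟨s, hs⟩ := hφ (ModuleCat.of A E) hET ψ
    have hs' : ∀ a, s (φ a) = ψ a := fun a => LinearMap.congr_fun hs a
    have hψ' : ∀ a, p (ψ a) = φ a := fun a => LinearMap.congr_fun hψ a
    let s' : T₀ →ₗ[A] E := s
    have hc : Surjective (p ∘ₗ s') := hsurj _ (fun a => by
      rw [LinearMap.comp_apply]
      exact (congrArg p (hs' a)).trans (hψ' a))
    have hb : Bijective (p ∘ₗ s') :=
      ⟨IsNoetherian.injective_of_surjective_endomorphism _ hc, hc⟩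
    let e := LinearEquiv.ofBijective (p ∘ₗ s') hb
    have he : ∀ x, p (s' (e.symm x)) = x := fun x => e.apply_symm_apply x
    obtain ⟨r, hr⟩ := hlp_lift i hi (LinearMap.id - s' ∘ₗ e.symm.toLinearMap ∘ₗ p) (fun x =>
      hex _ (by simp [he]))
    refine ⟨r, fun y => hi ?_⟩
    rw [hr]; simp [hpi]
  · have := hT1.fin
    obtain ⟨n, v, hv⟩ := Module.Finite.exists_fin (R := A) (M := T)
    choose h hh using fun j : Fin n => hφ T hT1 (LinearMap.toSpanSingleton A T (v j))
    have hh' : ∀ j, h j (φ 1) = v j := fun j => by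
      have := LinearMap.congr_fun (hh j) 1
      simpa using this
    refine ⟨Fin n, LinearMap.lsum A (fun _ => T₀) ℕ h, ?_⟩
    rw [← LinearMap.range_eq_top, eq_top_iff, ← hv, Submodule.span_le]
    rintro _ ⟨j, rfl⟩
    refine ⟨Pi.single j (φ 1), ?_⟩
    rw [LinearMap.lsum_piSingle, hh']

/-- Ext vanishing against the brick-like torsion modules. -/
theorem ext_of_brick [IsArtinianRing A] (hher : IsHereditaryRing A) (hbs : P.IsBrickSplitting)
    (T : Type) [AddCommGroup T] [Module A T] (hT : Tor P T) (hr : ExtV A T T)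
    (hb : ∀ f : T →ₗ[A] T, f ≠ 0 → Bijective f) :
    ∀ (m : ℕ∞) (F : Type) [AddCommGroup F] [Module A F], Fre P F → Module.length A F = m →
      ExtV A F T := by
  intro m
  induction m using WellFoundedLT.induction with
  | ind m ih =>
  intro F _ _ hF hm
  have := hF.fin
  have hTf := hT.fin
  have hsub : ∀ N : Submodule A F, N ≠ ⊤ → ExtV A N T := fun N hN =>
    ih _ (hm ▸ Submodule.length_lt hN) N (hF.sub N.subtype Subtype.val_injective) rfl
  by_contra hne
  have hFb : ∀ f : F →ₗ[A] F, f ≠ 0 → Bijective f := by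
    intro f hf
    by_contra hnb
    refine hne (ExtV.mid hher f (hsub _ fun h => hf (LinearMap.ker_eq_top.1 h))
      (hsub _ fun h => hnb ?_))
    have h' := LinearMap.range_eq_top.1 h
    exact ⟨IsNoetherian.injective_of_surjective_endomorphism f h', h'⟩
  have hFT : ∀ f : F →ₗ[A] T, f = 0 := by
    intro f
    by_contra hf
    exact hne (ExtV.mid hher f (hsub _ fun h => hf (LinearMap.ker_eq_top.1 h))
      (hr.sub hher (LinearMap.range f).subtype Subtype.val_injective))
  refine hne (extV_of_split ?_)
  intro E _ _ i p hi hp hex hpi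
  by_contra hns
  have hE := finite_ext i p hp hex hpi
  have hnsec : ∀ s : F →ₗ[A] E, ¬ ∀ x, p (s x) = x := by
    intro s hs
    obtain ⟨r, hr⟩ := hlp_lift i hi (LinearMap.id - s ∘ₗ p) (fun x => hex _ (by simp [hs]))
    refine hns ⟨r, fun y => hi ?_⟩
    rw [hr]; simp [hpi]
  have hTn : Nontrivial T := by
    by_contra h
    rw [not_nontrivial_iff_subsingleton] at h
    exact hne extV_of_subsingleton_right
  have hEb : IsBrick A (ModuleCat.of A E) := by
    refine ⟨hi.nontrivial, fun (f : E →ₗ[A] E) hf => ?_⟩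
    change Bijective f
    obtain ⟨a, ha⟩ := hlp_lift i hi (f ∘ₗ i) (fun y => hex _
      (tor_fre_hom hT hF (p ∘ₗ f ∘ₗ i) y))
    obtain ⟨c, hc⟩ := hlp_desc p hp (p ∘ₗ f) (fun e he => by
      obtain ⟨y, rfl⟩ := hex e he
      exact tor_fre_hom hT hF (p ∘ₗ f ∘ₗ i) y)
    have ha' : ∀ y, i (a y) = f (i y) := ha
    have hc' : ∀ e, c (p e) = p (f e) := hc
    by_cases ha0 : a = 0
    · exfalso
      obtain ⟨f', hf'⟩ := hlp_desc p hp f (fun e he => by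
        obtain ⟨y, rfl⟩ := hex e he
        rw [← ha', ha0]; simp)
      have hpf : ∀ x, p (f' x) = c x := fun x => by
        obtain ⟨e, rfl⟩ := hp x
        rw [hf', hc']
      by_cases hc0 : c = 0
      · obtain ⟨g, hg⟩ := hlp_lift i hi f' (fun x => hex _ (by rw [hpf, hc0]; rfl))
        apply hf
        ext e
        rw [← hf', ← hg, hFT g]; simp
      · let e := LinearEquiv.ofBijective c (hFb c hc0)
        apply hnsec (f' ∘ₗ e.symm.toLinearMap)
        intro x
        rw [LinearMap.comp_apply, hpf]
        exact e.apply_symm_apply x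
    · have hab := hb a ha0
      by_cases hc0 : c = 0
      · exfalso
        obtain ⟨g, hg⟩ := hlp_lift i hi f (fun e => hex _ (by rw [← hc', hc0]; rfl))
        let ea := LinearEquiv.ofBijective a hab
        refine hns ⟨ea.symm.toLinearMap ∘ₗ g, fun y => ?_⟩
        have : g (i y) = a y := hi (by rw [hg, ha'])
        rw [LinearMap.comp_apply, this]
        exact ea.symm_apply_apply y
      · have hcb := hFb c hc0
        apply IsArtinian.bijective_of_injective_endomorphism
        rw [← LinearMap.ker_eq_bot, LinearMap.ker_eq_bot']
        intro e he
        have h1 : p e = 0 := hcb.1 (by rw [hc', he, map_zero, map_zero])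
        obtain ⟨y, rfl⟩ := hex e h1
        have : a y = 0 := hi (by rw [ha', he, map_zero])
        rw [hab.1 (this.trans (map_zero a).symm), map_zero]
  rcases hbs (ModuleCat.of A E) hE hEb with h | h
  · have h' : Tor P E := h
    have := tor_fre (h'.quot p hp) hF
    exact hne extV_of_subsingleton_left
  · have h' : Fre P E := h
    have := tor_fre hT (h'.sub i hi)
    exact hne extV_of_subsingleton_right

theorem ext_of_proj [IsArtinianRing A] (hher : IsHereditaryRing A) (hbs : P.IsBrickSplitting) :
    ∀ (m : ℕ∞) (T : Type) [AddCommGroup T] [Module A T], Tor P T →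
      (∀ T' : ModuleCat.{0} A, Tor P T' → ExtV A T T') → Module.length A T = m →
      ∀ (F : Type) [AddCommGroup F] [Module A F], Fre P F → ExtV A F T := by
  intro m
  induction m using WellFoundedLT.induction with
  | ind m ih =>
  intro T _ _ hT hproj hm F _ _ hF
  have hTf := hT.fin
  by_contra hne
  have hsub : ∀ N N' : Submodule A T, IsCompl N N' → N' ≠ ⊥ → ExtV A F N := by
    intro N N' hc hN'
    have hN : N ≠ ⊤ := by
      rintro rfl
      exact hN' (by simpa using hc.inf_eq_bot)
    refine ih _ (hm ▸ Submodule.length_lt hN) N ?_ ?_ rfl F hF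
    · exact hT.quot (N.projectionOnto N' hc) (Submodule.projectionOnto_surjective hc)
    · intro T' hT'
      exact (hproj T' hT').sub hher N.subtype Subtype.val_injective
  have hind : ∀ (N₁ N₂ : Submodule A T), IsCompl N₁ N₂ → N₁ = ⊥ ∨ N₂ = ⊥ := by
    intro N₁ N₂ hc
    by_contra h
    push Not at h
    exact hne (ExtV.compl hc (hsub _ _ hc h.2) (hsub _ _ hc.symm h.1))
  have hr : ExtV A T T := hproj (ModuleCat.of A T) hT
  exact hne (ext_of_brick hher hbs T hT hr (rigid_brick hher hr hind) _ F hF rfl)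

end Torsion

theorem stmt1 (k A : Type) [Field k] [Ring A] [Algebra k A] [FiniteDimensional k A]
    (hher : IsHereditaryRing A)
    (P : TorsionPair A) (hff : P.IsFunctoriallyFinite) :
    P.IsSplitting ↔ P.IsBrickSplitting := by
  have hart : IsArtinianRing A := IsArtinianRing.of_finite k A
  constructor
  · intro h M hM hb
    refine h M hM ⟨hb.1, fun N₁ N₂ hc => ?_⟩
    by_cases h0 : N₁.subtype ∘ₗ N₁.projectionOnto N₂ hc = 0
    · left
      rw [eq_bot_iff]
      intro x hx
      have h1 := LinearMap.congr_fun h0 x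
      have h2 := Submodule.projectionOnto_apply_left hc ⟨x, hx⟩
      rw [LinearMap.comp_apply] at h1
      change N₁.projectionOnto N₂ hc x = _ at h2
      rw [h2] at h1
      exact h1
    · right
      have h1 := (hb.2 _ h0).1
      rw [eq_bot_iff]
      intro x hx
      apply h1
      have h2 := Submodule.projectionOnto_apply_right hc ⟨x, hx⟩
      change N₁.projectionOnto N₂ hc x = _ at h2
      rw [LinearMap.comp_apply, h2, map_zero, map_zero]
  · intro hbs M hM hind
    obtain ⟨T₀, hT₀, hproj, hgen⟩ := exists_gen hff
    obtain ⟨t, ht, hf⟩ := exists_tor P M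
    have hext : ExtV A (M ⧸ t) t := by
      obtain ⟨n, q, hq⟩ := hgen (ModuleCat.of A t) ht
      exact ExtV.quot hher (ExtV.pi (ext_of_proj hher hbs _ T₀ hT₀ hproj rfl _ hf)) q hq
    obtain ⟨s, hs⟩ := hext.split t.subtype Subtype.val_injective t.mkQ t.mkQ_surjective
      (fun e he => ⟨⟨e, by
        rwa [Submodule.mkQ_apply, Submodule.Quotient.mk_eq_zero] at he⟩, rfl⟩)
      (fun y => by simp)
    have hc : IsCompl t (LinearMap.range s) := by
      constructor
      · rw [Submodule.disjoint_def]
        rintro _ hx ⟨y, rfl⟩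
        have h1 : t.mkQ (s y) = 0 := by
          rwa [Submodule.mkQ_apply, Submodule.Quotient.mk_eq_zero]
        rw [hs] at h1
        rw [h1, map_zero]
      · rw [codisjoint_iff, eq_top_iff]
        intro x _
        rw [Submodule.mem_sup]
        refine ⟨x - s (t.mkQ x), ?_, s (t.mkQ x), ⟨_, rfl⟩, by abel⟩
        rw [← Submodule.Quotient.mk_eq_zero, ← Submodule.mkQ_apply, map_sub, hs, sub_self]
    rcases hind.2 _ _ hc with h | h
    · right
      refine hf.sub t.mkQ ?_
      rw [← LinearMap.ker_eq_bot, Submodule.ker_mkQ, h]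
    · left
      refine ht.quot t.subtype (fun x => ?_)
      rw [h] at hc
      have := hc.sup_eq_top
      rw [sup_bot_eq] at this
      exact ⟨⟨x, this ▸ Submodule.mem_top⟩, rfl⟩
end

section
/- Let A be a connected finite-dimensional algebra and (T,F) a brick-splitting torsion pair in mod A. Then for every simple A-module S_1 belonging to T and every simple A-module S_2 belonging to F one has Ext^1_A(S_2, S_1) = 0; hence in the Ext-quiver of A there is no arrow from a vertex corresponding to a simple module in F to a vertex corresponding to a simple module in T. -/
open Function

/-- A finite-dimensional algebra is connected (indecomposable) iff it has
no nontrivial central idempotent, equivalently its Ext-quiver is connected. -/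
def IsConnectedAlgebra (A : Type) [Ring A] : Prop :=
  (0 : A) ≠ 1 ∧ ∀ e : A, IsIdempotentElem e → (∀ a : A, a * e = e * a) → e = 0 ∨ e = 1

/-- `Ext^1_A(S₂, S₁) = 0`, expressed by the splitting of every short exact sequence
`0 → S₁ → E → S₂ → 0`. -/
theorem stmt2 (k A : Type) [Field k] [Ring A] [Algebra k A] [FiniteDimensional k A]
    (hconn : IsConnectedAlgebra A)
    (P : TorsionPair A) (hP : P.IsBrickSplitting)
    (S₁ S₂ : ModuleCat.{0} A)
    (h1 : IsSimpleModule A S₁) (h1T : S₁ ∈ P.torsion)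
    (h2 : IsSimpleModule A S₂) (h2F : S₂ ∈ P.torsionFree) :
    ∀ (E : ModuleCat.{0} A) (i : S₁ →ₗ[A] E) (p : E →ₗ[A] S₂),
      Function.Injective i → Function.Surjective p → Function.Exact i p →
      ∃ s : S₂ →ₗ[A] E, p ∘ₗ s = LinearMap.id := by
  intro E i p hi hp hex
  by_contra hns
  haveI := h1
  haveI := h2
  haveI n1 : Nontrivial S₁ := IsSimpleModule.nontrivial A S₁
  haveI n2 : Nontrivial S₂ := IsSimpleModule.nontrivial A S₂
  have hsplit : ∀ (N : Type) [AddCommGroup N] [Module A N] (q : N →ₗ[A] E),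
      ¬ Function.Bijective (p ∘ₗ q) := by
    intro N _ _ q hq
    apply hns
    let e := LinearEquiv.ofBijective (p ∘ₗ q) hq
    refine ⟨q ∘ₗ e.symm.toLinearMap, ?_⟩
    ext x
    exact e.apply_symm_apply x
  have hrk : LinearMap.range i = LinearMap.ker p := hex.linearMap_ker_eq.symm
  haveI : IsNoetherian A E := isNoetherian_of_range_eq_ker i p hrk
  haveI : IsArtinian A E := isArtinian_of_range_eq_ker i p hrk
  have hnoiso : ∀ g : S₂ →ₗ[A] S₁, g = 0 := by
    intro g
    rcases g.bijective_or_eq_zero with hb | h0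
    · exact absurd n1 (P.inter_zero S₁ h1T
        (P.torsionFree_iso S₂ h2F S₁ (LinearEquiv.ofBijective g hb)))
    · exact h0
  have hbrick : IsBrick A E := by
    refine ⟨hi.nontrivial, fun f hf => ?_⟩
    apply IsArtinian.bijective_of_injective_endomorphism
    rcases (f ∘ₗ i).injective_or_eq_zero with hinj | h0
    · rw [← LinearMap.ker_eq_bot]
      by_contra hk
      have hqi : Function.Injective (p ∘ₗ (LinearMap.ker f).subtype) := by
        rw [← LinearMap.ker_eq_bot, LinearMap.ker_eq_bot']
        rintro ⟨x, hx⟩ hpx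
        obtain ⟨y, rfl⟩ := (hex x).1 hpx
        have : y = 0 := by
          apply hinj
          rw [map_zero]
          exact hx
        subst this
        ext
        simp
      haveI : Nontrivial (LinearMap.ker f) := Submodule.nontrivial_iff_ne_bot.2 hk
      refine hsplit _ (LinearMap.ker f).subtype ⟨hqi, ?_⟩
      apply (LinearMap.surjective_or_eq_zero _).resolve_right
      intro h
      obtain ⟨x, hx⟩ := exists_ne (0 : LinearMap.ker f)
      exact hx (hqi (by rw [h]; simp))
    · exfalso
      have hle : LinearMap.ker p ≤ LinearMap.ker f := by
        intro x hx
        obtain ⟨y, rfl⟩ := (hex x).1 hx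
        exact LinearMap.congr_fun h0 y
      obtain ⟨g, hg⟩ : ∃ g : S₂ →ₗ[A] E, g ∘ₗ p = f := by
        let e := p.quotKerEquivOfSurjective hp
        refine ⟨(LinearMap.ker p).liftQ f hle ∘ₗ e.symm.toLinearMap, ?_⟩
        ext x
        have : e.symm (p x) = Submodule.Quotient.mk x := by
          rw [LinearEquiv.symm_apply_eq]; rfl
        simp [this]
      have hpg : p ∘ₗ g = 0 :=
        (LinearMap.bijective_or_eq_zero (p ∘ₗ g)).resolve_left (hsplit _ g)
      let ei := LinearEquiv.ofInjective i hi
      have hmem : ∀ x, g x ∈ LinearMap.range i := fun x => by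
        rw [hrk]; exact LinearMap.congr_fun hpg x
      have hz := hnoiso (ei.symm.toLinearMap ∘ₗ g.codRestrict _ hmem)
      apply hf
      rw [← hg]
      ext x
      have h3 := LinearMap.congr_fun hz (p x)
      have h4 : g.codRestrict _ hmem (p x) = 0 := by simpa using h3
      simpa using congrArg Subtype.val h4
  rcases hP E inferInstance hbrick with hT | hF
  · exact P.inter_zero S₂ (P.torsion_quot E hT S₂ p hp) h2F n2
  · exact P.inter_zero S₁ h1T (P.torsionFree_sub E hF S₁ i hi) n1
end

section
/- If a finite-dimensional algebra A is fully cyclic, then the only brick-splitting torsion pairs in mod A are the trivial ones (0, mod A) and (mod A, 0). In particular, if A is a connected self-injective algebra, then the only brick-splitting torsion pairs in mod A are (0, mod A) and (mod A, 0). -/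
open Function

/-- `A` is fully cyclic if for every idempotent `e`, `eA(1-e) = 0` implies `e = 0` or `e = 1`. -/
def IsFullyCyclic (A : Type) [Ring A] : Prop :=
  ∀ e : A, IsIdempotentElem e → (∀ a : A, e * a * (1 - e) = 0) → e = 0 ∨ e = 1

/-- The torsion pair `(T,F)` is trivial, i.e. equals `(0, mod A)` or `(mod A, 0)`. -/
def TorsionPair.IsTrivial {A : Type} [Ring A] (P : TorsionPair A) : Prop :=
  ((∀ M ∈ P.torsion, ¬ Nontrivial M) ∧
    (∀ M : ModuleCat.{0} A, Module.Finite A M → M ∈ P.torsionFree)) ∨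
  ((∀ M : ModuleCat.{0} A, Module.Finite A M → M ∈ P.torsion) ∧
    (∀ M ∈ P.torsionFree, ¬ Nontrivial M))


/-! ### Simple modules over artinian rings -/

section Simple

variable {A : Type} [Ring A] [IsArtinianRing A]

theorem isSemisimple_quot_jacobson :
    IsSemisimpleModule A (A ⧸ Ring.jacobson A) :=
  (IsArtinian.isSemisimpleModule_iff_jacobson A (A ⧸ Ring.jacobson A)).mpr
    (Module.jacobson_quotient_jacobson A A)

theorem iso_of_annihilator_le (S S' : Type) [AddCommGroup S] [AddCommGroup S'] [Module A S]
    [Module A S'] [IsSimpleModule A S] [IsSimpleModule A S']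
    (h : Module.annihilator A S ≤ Module.annihilator A S') : Nonempty (S ≃ₗ[A] S') := by
  let 𝒮 : Set (Ideal A) := {I | ∃ (n : ℕ) (v : Fin n → S), ∀ a, a ∈ I ↔ ∀ i, a • v i = 0}
  have hne : 𝒮.Nonempty := ⟨⊤, 0, Fin.elim0, by simp⟩
  obtain ⟨I, ⟨n, v, hv⟩, hmin⟩ := WellFounded.has_min (wellFounded_lt (α := Ideal A)) 𝒮 hne
  have hI : ∀ a ∈ I, ∀ s : S, a • s = 0 := by
    intro a ha s
    let I' : Ideal A := I ⊓ LinearMap.ker (LinearMap.toSpanSingleton A S s)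
    have hI' : I' ∈ 𝒮 := by
      refine ⟨n + 1, Fin.cons s v, fun a => ?_⟩
      rw [Fin.forall_fin_succ]
      simp [I', hv, and_comm]
    have : ¬ I' < I := hmin I' hI'
    have hle : I' ≤ I := inf_le_left
    have heq : I' = I := by
      by_contra hne
      exact this (lt_of_le_of_ne hle hne)
    have : a ∈ I' := heq ▸ ha
    simpa using this.2
  let φ : A →ₗ[A] (Fin n → S) := LinearMap.pi fun i => LinearMap.toSpanSingleton A S (v i)
  have hker : LinearMap.ker φ = I := by
    ext a
    rw [hv a, LinearMap.mem_ker]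
    simp [φ, funext_iff]
  have : IsSemisimpleModule A (LinearMap.range φ) := inferInstance
  obtain ⟨s', hs'⟩ := @exists_ne S' (IsSimpleModule.nontrivial A S') 0
  have hle : LinearMap.ker φ ≤ LinearMap.ker (LinearMap.toSpanSingleton A S' s') := by
    intro a ha
    rw [hker] at ha
    have : a ∈ Module.annihilator A S' := h (Module.mem_annihilator.mpr (hI a ha))
    simpa using Module.mem_annihilator.mp this s'
  let ψ : (A ⧸ LinearMap.ker φ) →ₗ[A] S' := (LinearMap.ker φ).liftQ _ hle
  have : IsSemisimpleModule A (A ⧸ LinearMap.ker φ) :=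
    IsSemisimpleModule.congr φ.quotKerEquivRange
  have hψ : ψ ≠ 0 := by
    intro h0
    apply hs'
    have := LinearMap.congr_fun h0 (Submodule.Quotient.mk (1 : A))
    simpa [ψ] using this
  obtain ⟨N, ⟨eN⟩⟩ := LinearMap.linearEquiv_of_ne_zero hψ
  let θ : S' →ₗ[A] (Fin n → S) :=
    (LinearMap.range φ).subtype ∘ₗ φ.quotKerEquivRange.toLinearMap ∘ₗ N.subtype ∘ₗ eN.toLinearMap
  have hθ : Function.Injective θ := by
    refine (LinearMap.range φ).injective_subtype.comp ?_
    exact φ.quotKerEquivRange.injective.comp (N.injective_subtype.comp eN.injective)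
  have : ∃ i, (LinearMap.proj i ∘ₗ θ) ≠ 0 := by
    by_contra! hall
    apply hs'
    apply hθ
    rw [map_zero]
    ext i
    exact LinearMap.congr_fun (hall i) s'
  obtain ⟨i, hi⟩ := this
  exact ⟨(LinearEquiv.ofBijective _ (LinearMap.bijective_of_ne_zero hi)).symm⟩

theorem finite_primitive :
    Set.Finite {P : Ideal A | ∃ m : Ideal A, IsSimpleModule A (A ⧸ m) ∧
      P = Module.annihilator A (A ⧸ m)} := by
  have hss := isSemisimple_quot_jacobson (A := A)
  have hfin : Set.Finite (isotypicComponents A (A ⧸ Ring.jacobson A)) :=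
    Set.toFinite _
  refine (hfin.image fun c : Submodule A (A ⧸ Ring.jacobson A) => Module.annihilator A c).subset ?_
  rintro P ⟨m, hm, rfl⟩
  have hle : Ring.jacobson A ≤ m := by
    have : m.IsMaximal := Ideal.isMaximal_def.mpr (isSimpleModule_iff_isCoatom.mp hm)
    exact Ring.jacobson_le_of_isMaximal m
  let ψ : (A ⧸ Ring.jacobson A) →ₗ[A] (A ⧸ m) := Submodule.factor hle
  have hψ : ψ ≠ 0 := by
    have := IsSimpleModule.nontrivial A (A ⧸ m)
    intro h0
    have hs : Function.Surjective ψ := Submodule.factor_surjective hle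
    obtain ⟨y, hy⟩ := exists_ne (0 : A ⧸ m)
    obtain ⟨x, rfl⟩ := hs y
    exact hy (by rw [h0]; rfl)
  obtain ⟨N, ⟨eN⟩⟩ := LinearMap.linearEquiv_of_ne_zero hψ
  have hN : IsSimpleModule A N := IsSimpleModule.congr eN.symm
  refine ⟨isotypicComponent A _ N, ⟨N, hN, rfl⟩, ?_⟩
  change Module.annihilator A (isotypicComponent A _ N) = _
  rw [eN.annihilator_eq]
  apply le_antisymm
  · exact LinearMap.annihilator_le_of_injective (Submodule.inclusion N.le_isotypicComponent)
      (Submodule.inclusion_injective _)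
  · intro a ha
    rw [Module.mem_annihilator] at ha ⊢
    have key : ∀ x ∈ isotypicComponent A (A ⧸ Ring.jacobson A) N, a • x = 0 := by
      intro x hx
      unfold isotypicComponent at hx
      rw [sSup_eq_iSup'] at hx
      induction hx using Submodule.iSup_induction' with
      | mem i x hx =>
        obtain ⟨i, ⟨ei⟩⟩ := i
        have h1 := ha (ei ⟨x, hx⟩)
        rw [← map_smul, LinearEquiv.map_eq_zero_iff] at h1
        exact congrArg Subtype.val h1
      | zero => simp
      | add x y _ _ hx hy => rw [smul_add, hx, hy, add_zero]
    rintro ⟨x, hx⟩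
    exact Subtype.ext (key x hx)

theorem primitive_of_simple (S : Type) [AddCommGroup S] [Module A S] [IsSimpleModule A S] :
    ∃ m : Ideal A, IsSimpleModule A (A ⧸ m) ∧
      Module.annihilator A S = Module.annihilator A (A ⧸ m) := by
  obtain ⟨m, hm, ⟨e⟩⟩ := isSimpleModule_iff_quot_maximal.mp (inferInstance : IsSimpleModule A S)
  exact ⟨m, IsSimpleModule.congr e.symm, e.annihilator_eq⟩

/-- The main fact about self-injective algebras. -/
theorem selfinjective_idem [IsNoetherianRing Aᵐᵒᵖ] (hinj : Module.Injective A A) (e : A)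
    (he : IsIdempotentElem e)
    (h0 : ∀ a : A, e * a * (1 - e) = 0) (a : A) : (1 - e) * a * e = 0 := by
  by_contra hne
  let 𝓜 : Set (Ideal A) := {P | (∃ m : Ideal A, IsSimpleModule A (A ⧸ m) ∧
      P = Module.annihilator A (A ⧸ m)) ∧ e ∈ P}
  have hfin : Finite 𝓜 := (finite_primitive.subset fun P hP => hP.1).to_subtype
  -- left annihilators of proper right ideals are nonzero
  have step1 : ∀ P : 𝓜, ∃ S : Ideal A, IsSimpleModule A S ∧ ∀ x ∈ S, ∀ p ∈ P.1, x * p = 0 := by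
    rintro ⟨P, ⟨m, hm, rfl⟩, heP⟩
    set P := Module.annihilator A (A ⧸ m)
    let L : Ideal A :=
      { carrier := {x | ∀ p ∈ P, x * p = 0}
        add_mem' := fun hx hy p hp => by rw [add_mul, hx p hp, hy p hp, add_zero]
        zero_mem' := fun p _ => zero_mul p
        smul_mem' := fun c x hx p hp => by rw [smul_eq_mul, mul_assoc, hx p hp, mul_zero] }
    have hL : L ≠ ⊥ := by
      intro hbot
      let Pr : Submodule Aᵐᵒᵖ A :=
        { carrier := P
          add_mem' := fun hx hy => P.add_mem hx hy
          zero_mem' := P.zero_mem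
          smul_mem' := fun c x hx => by
            change x * c.unop ∈ P
            exact P.mul_mem_right _ hx }
      have : IsNoetherian Aᵐᵒᵖ A := by
        exact isNoetherian_of_linearEquiv (MulOpposite.opLinearEquiv Aᵐᵒᵖ (M := A)).symm
      obtain ⟨t, ht⟩ := (IsNoetherian.noetherian Pr)
      let φ : A →ₗ[A] (t → A) := LinearMap.pi fun i => LinearMap.toSpanSingleton A A i.1
      have hφ : Function.Injective φ := by
        rw [← LinearMap.ker_eq_bot, eq_bot_iff]
        intro x hx
        rw [← hbot]
        intro p hp
        have hp' : p ∈ Submodule.span Aᵐᵒᵖ (t : Set A) := by rw [ht]; exact hp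
        induction hp' using Submodule.span_induction with
        | mem y hy =>
          have := congrFun (LinearMap.mem_ker.mp hx) ⟨y, hy⟩
          simpa [φ] using this
        | zero => simp
        | add y z hy' hz' hy hz =>
          rw [ht] at hy' hz'
          rw [mul_add, hy hy', hz hz', add_zero]
        | smul c y hy' hy =>
          rw [ht] at hy'
          change x * (y * c.unop) = 0
          rw [← mul_assoc, hy hy', zero_mul]
      obtain ⟨h, hh⟩ := hinj.out φ hφ LinearMap.id
      have h1 := hh 1
      classical
      have h2 : h (φ 1) ∈ P := by
        have : φ 1 = ∑ i : t, i.1 • Pi.single i (1 : A) := by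
          ext j
          simp [φ, Finset.sum_apply, Pi.single_apply]
        rw [this, map_sum]
        refine P.sum_mem fun i _ => ?_
        rw [map_smul, smul_eq_mul]
        have hi : i.1 ∈ Pr := by rw [← ht]; exact Submodule.subset_span i.2
        exact P.mul_mem_right _ hi
      rw [h1] at h2
      have hn := IsSimpleModule.nontrivial A (A ⧸ m)
      obtain ⟨y, hy⟩ := exists_ne (0 : A ⧸ m)
      apply hy
      simpa using Module.mem_annihilator.mp h2 y
    obtain ⟨S, hS, hSL⟩ := (IsAtomic.eq_bot_or_exists_atom_le L).resolve_left hL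
    exact ⟨S, isSimpleModule_iff_isAtom.mpr hS, fun x hx => hSL hx⟩
  choose S hS hSP using step1
  have hSe : ∀ P, ∀ x ∈ S P, x * e = 0 := fun P x hx => hSP P x hx e P.2.2
  have heS : ∀ P, ∀ x ∈ S P, e * x = 0 := by
    intro P x hx
    have h1 := h0 x
    rwa [mul_assoc, mul_sub, mul_one, hSe P x hx, sub_zero] at h1
  let ν : 𝓜 → 𝓜 := fun P => ⟨Module.annihilator A (S P), primitive_of_simple (S P), by
    rw [Module.mem_annihilator]
    rintro ⟨x, hx⟩
    exact Subtype.ext (heS P x hx)⟩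
  have extend : ∀ (I : Ideal A) (g : I →ₗ[A] A), ∃ b : A, ∀ x : I, g x = x.1 * b := by
    intro I g
    obtain ⟨h, hh⟩ := hinj.out I.subtype I.injective_subtype g
    refine ⟨h 1, fun x => ?_⟩
    rw [← hh x, ← smul_eq_mul, ← map_smul]
    simp
  have hν : Function.Injective ν := by
    intro P Q hPQ
    obtain ⟨u⟩ := iso_of_annihilator_le (S P) (S Q) (congrArg Subtype.val hPQ).le
    obtain ⟨b, hb⟩ := extend (S P) ((S Q).subtype ∘ₗ u.toLinearMap)
    have hQ : ∀ y ∈ S Q, ∀ p ∈ P.1, y * p = 0 := by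
      intro y hy p hp
      have h1 := hb (u.symm ⟨y, hy⟩)
      simp at h1
      rw [h1, mul_assoc]
      obtain ⟨⟨m, hm, hPm⟩, _⟩ := P.2
      have : b * p ∈ P.1 := P.1.mul_mem_left b hp
      exact hSP P _ (u.symm ⟨y, hy⟩).2 _ this
    -- comaximality
    have hsup : ¬ (P.1 ⊔ Q.1 = ⊤) := by
      intro htop
      obtain ⟨p, hp, q, hq, hpq⟩ := Submodule.mem_sup.mp
        (htop ▸ Submodule.mem_top : (1 : A) ∈ P.1 ⊔ Q.1)
      have := IsSimpleModule.nontrivial A (S Q)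
      obtain ⟨y, hy⟩ := exists_ne (0 : S Q)
      apply hy
      apply Subtype.ext
      change y.1 = 0
      rw [← mul_one y.1, ← hpq, mul_add, hQ _ y.2 p hp, hSP Q _ y.2 q hq, add_zero]
    obtain ⟨n, hn, hle⟩ := Ideal.exists_le_maximal _ hsup
    have hnS : IsSimpleModule A (A ⧸ n) := isSimpleModule_iff_isCoatom.mpr hn.out
    have aux : ∀ R : 𝓜, R.1 ≤ n → R.1 = Module.annihilator A (A ⧸ n) := by
      rintro ⟨R, ⟨m, hm, rfl⟩, _⟩ hRn
      change Module.annihilator A (A ⧸ m) ≤ n at hRn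
      change Module.annihilator A (A ⧸ m) = _
      have : Module.annihilator A (A ⧸ m) ≤ Module.annihilator A (A ⧸ n) := by
        intro r hr
        rw [Module.mem_annihilator]
        intro y
        obtain ⟨y, rfl⟩ := Submodule.Quotient.mk_surjective _ y
        rw [← Submodule.Quotient.mk_smul, Submodule.Quotient.mk_eq_zero]
        exact hRn ((Module.annihilator A (A ⧸ m)).mul_mem_right y hr)
      obtain ⟨u⟩ := iso_of_annihilator_le _ _ this
      exact u.annihilator_eq
    exact Subtype.ext ((aux P (le_sup_left.trans hle)).trans (aux Q (le_sup_right.trans hle)).symm)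
  have hsurj : Function.Surjective ν := Finite.surjective_of_injective hν
  let X : Ideal A :=
    { carrier := {x | x * e = x ∧ e * x = 0}
      add_mem' := fun hx hy => ⟨by rw [add_mul, hx.1, hy.1], by rw [mul_add, hx.2, hy.2, add_zero]⟩
      zero_mem' := by simp
      smul_mem' := fun c x hx => ⟨by rw [smul_eq_mul, mul_assoc, hx.1], by
        have h1 : e * c = e * c * e := by
          have := h0 c
          rwa [mul_sub, mul_one, sub_eq_zero] at this
        rw [smul_eq_mul, ← mul_assoc, h1, mul_assoc, hx.2, mul_zero]⟩ }
  have hXmem : (1 - e) * a * e ∈ X := by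
    constructor
    · rw [mul_assoc, he.eq]
    · rw [← mul_assoc, ← mul_assoc, mul_sub, mul_one, he.eq, sub_self, zero_mul, zero_mul]
  have hXnt : Nontrivial X := ⟨⟨⟨_, hXmem⟩, 0, fun h => hne (congrArg Subtype.val h)⟩⟩
  obtain ⟨N, hN, -⟩ := (IsCoatomic.eq_top_or_exists_le_coatom (⊥ : Submodule A X)).resolve_left
    bot_ne_top
  have hNs : IsSimpleModule A (X ⧸ N) := isSimpleModule_iff_isCoatom.mpr hN
  let Q : 𝓜 := ⟨Module.annihilator A (X ⧸ N), primitive_of_simple _, by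
    rw [Module.mem_annihilator]
    intro y
    obtain ⟨y, rfl⟩ := Submodule.Quotient.mk_surjective _ y
    rw [← Submodule.Quotient.mk_smul]
    have : e • y = 0 := Subtype.ext y.2.2
    rw [this, Submodule.Quotient.mk_zero]⟩
  obtain ⟨P, hP⟩ := hsurj Q
  obtain ⟨u⟩ := iso_of_annihilator_le (X ⧸ N) (S P) (congrArg Subtype.val hP).ge
  obtain ⟨b, hb⟩ := extend X ((S P).subtype ∘ₗ u.toLinearMap ∘ₗ N.mkQ)
  have hz : ∀ x : X, (u (N.mkQ x) : A) = 0 := by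
    intro x
    have h1 : (u (N.mkQ x) : A) = x.1 * b := hb x
    have h2 : x.1 * b * e = 0 := by rw [← h1]; exact hSe P _ (u (N.mkQ x)).2
    have h3 : x.1 * (e * b * (1 - e)) = x.1 * b := by
      rw [← mul_assoc, ← mul_assoc, x.2.1, mul_sub, mul_one, h2, sub_zero]
    rw [h1, ← h3, h0, mul_zero]
  have := IsSimpleModule.nontrivial A (X ⧸ N)
  obtain ⟨y, hy⟩ := exists_ne (0 : X ⧸ N)
  obtain ⟨x, rfl⟩ := N.mkQ_surjective y
  apply hy
  apply u.injective
  rw [map_zero]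
  exact Subtype.ext (hz x)

end Simple

/-! ### Torsion pairs -/

section Torsion

variable {A : Type} [Ring A]

theorem TorsionPair.hom_zero (P : TorsionPair A) {X Y : Type} [AddCommGroup X] [AddCommGroup Y]
    [Module A X] [Module A Y] (hX : ModuleCat.of A X ∈ P.torsion)
    (hY : ModuleCat.of A Y ∈ P.torsionFree) (f : X →ₗ[A] Y) : f = 0 := by
  have h1 : ModuleCat.of A (LinearMap.range f) ∈ P.torsion :=
    P.torsion_quot _ hX (ModuleCat.of A (LinearMap.range f)) f.rangeRestrict
      f.surjective_rangeRestrict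
  have h2 : ModuleCat.of A (LinearMap.range f) ∈ P.torsionFree :=
    P.torsionFree_sub _ hY (ModuleCat.of A (LinearMap.range f)) (LinearMap.range f).subtype
      (LinearMap.range f).injective_subtype
  have h3 : ¬ Nontrivial (LinearMap.range f) := P.inter_zero _ h1 h2
  rw [Submodule.nontrivial_iff_ne_bot, not_not] at h3
  exact LinearMap.range_eq_bot.mp h3

theorem isBrick_of_simple (S : Type) [AddCommGroup S] [Module A S] [IsSimpleModule A S] :
    IsBrick A (ModuleCat.of A S) :=
  ⟨IsSimpleModule.nontrivial A S, fun f hf =>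
    LinearMap.bijective_of_ne_zero (M := S) (N := S) (R := A) hf⟩

variable [IsArtinianRing A]

theorem TorsionPair.exists_idem (P : TorsionPair A) (hP : P.IsBrickSplitting) :
    ∃ e : A, IsIdempotentElem e ∧
      (∀ (S : Type) [AddCommGroup S] [Module A S] [IsSimpleModule A S],
        ModuleCat.of A S ∈ P.torsionFree → ∀ s : S, e • s = 0) ∧
      (∀ (S : Type) [AddCommGroup S] [Module A S] [IsSimpleModule A S],
        ModuleCat.of A S ∈ P.torsion → ∀ s : S, e • s = s) := by
  have hss := isSemisimple_quot_jacobson (A := A)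
  obtain ⟨t, htT, htF⟩ := P.exists_torsionSub (ModuleCat.of A (A ⧸ Ring.jacobson A))
    (inferInstanceAs (Module.Finite A (A ⧸ Ring.jacobson A)))
  change Submodule A (A ⧸ Ring.jacobson A) at t
  obtain ⟨C, hC⟩ := exists_isCompl t
  have hCF : ModuleCat.of A C ∈ P.torsionFree :=
    P.torsionFree_iso _ htF (ModuleCat.of A C) (t.quotientEquivOfIsCompl C hC)
  obtain ⟨x', hx', y', hy', hxy⟩ := Submodule.mem_sup.mp
    (hC.sup_eq_top ▸ Submodule.mem_top :
      (Submodule.Quotient.mk (1 : A) : A ⧸ Ring.jacobson A) ∈ t ⊔ C)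
  obtain ⟨x, rfl⟩ := Submodule.Quotient.mk_surjective _ x'
  obtain ⟨y, rfl⟩ := Submodule.Quotient.mk_surjective _ y'
  have hev : ∀ (S : Type) [AddCommGroup S] [Module A S] [IsSimpleModule A S] (s : S),
      ∃ φ : (A ⧸ Ring.jacobson A) →ₗ[A] S, ∀ a : A, φ (Submodule.Quotient.mk a) = a • s := by
    intro S _ _ _ s
    refine ⟨(Ring.jacobson A).liftQ (LinearMap.toSpanSingleton A S s) ?_, fun a => rfl⟩
    intro a ha
    have := IsSemisimpleModule.jacobson_le_annihilator A S ha
    simpa using Module.mem_annihilator.mp this s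
  have hxF : ∀ (S : Type) [AddCommGroup S] [Module A S] [IsSimpleModule A S],
        ModuleCat.of A S ∈ P.torsionFree → ∀ s : S, x • s = 0 := by
    intro S _ _ _ hS s
    obtain ⟨φ, hφ⟩ := hev S s
    have h0 := P.hom_zero (X := t) (Y := S) htT hS (φ ∘ₗ t.subtype)
    rw [← hφ]
    exact LinearMap.congr_fun h0 ⟨_, hx'⟩
  have hxT : ∀ (S : Type) [AddCommGroup S] [Module A S] [IsSimpleModule A S],
        ModuleCat.of A S ∈ P.torsion → ∀ s : S, x • s = s := by
    intro S _ _ _ hS s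
    obtain ⟨φ, hφ⟩ := hev S s
    have h0 : φ ∘ₗ C.subtype = 0 := by
      by_contra hne
      have hsur := LinearMap.surjective_of_ne_zero hne
      obtain ⟨g, hg⟩ := IsSemisimpleModule.lifting_property (φ ∘ₗ C.subtype) hsur
        (LinearMap.id : S →ₗ[A] S)
      have hg0 := P.hom_zero (X := S) (Y := C) hS hCF g
      have := IsSimpleModule.nontrivial A S
      obtain ⟨z, hz⟩ := exists_ne (0 : S)
      apply hz
      have h2 := LinearMap.congr_fun hg z
      rw [hg0] at h2
      simpa using h2.symm
    have hy0 : y • s = 0 := by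
      rw [← hφ]
      exact LinearMap.congr_fun h0 ⟨_, hy'⟩
    have h1 := congrArg φ hxy
    rw [map_add, hφ, hφ, hφ, hy0, add_zero, one_smul] at h1
    exact h1
  have hsplit : ∀ (S : Type) [AddCommGroup S] [Module A S] [IsSimpleModule A S],
      ModuleCat.of A S ∈ P.torsion ∨ ModuleCat.of A S ∈ P.torsionFree := fun S _ _ _ =>
    hP _ (inferInstanceAs (Module.Finite A S)) (isBrick_of_simple S)
  have hidem : x * x - x ∈ Ring.jacobson A := by
    rw [Ring.jacobson_eq_sInf_isMaximal, Ideal.mem_sInf]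
    intro m hm
    have hm' : m.IsMaximal := hm
    have : IsSimpleModule A (A ⧸ m) := isSimpleModule_iff_isCoatom.mpr hm'.out
    have : (x * x - x) • (Submodule.Quotient.mk (1 : A) : A ⧸ m) = 0 := by
      rw [sub_smul, mul_smul]
      rcases hsplit (A ⧸ m) with h | h
      · rw [hxT _ h, hxT _ h, sub_self]
      · rw [hxF _ h, hxF _ h, sub_self]
    rw [← Submodule.Quotient.mk_smul, Submodule.Quotient.mk_eq_zero] at this
    simpa using this
  obtain ⟨e, he, hex⟩ := exists_isIdempotentElem_eq_of_ker_isNilpotent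
    (Ideal.Quotient.mk (Ring.jacobson A)) (by
      intro z hz
      rw [Ideal.mk_ker] at hz
      obtain ⟨n, hn⟩ := IsSemiprimaryRing.isNilpotent (R := A)
      refine ⟨n, ?_⟩
      have : z ^ n ∈ Ring.jacobson A ^ n := Ideal.pow_mem_pow hz n
      rw [hn] at this
      exact this) (Ideal.Quotient.mk _ x) ⟨x, rfl⟩ (by
        rw [IsIdempotentElem, ← map_mul]
        exact Ideal.Quotient.eq.mpr hidem)
  have hex' : e - x ∈ Ring.jacobson A := Ideal.Quotient.eq.mp hex
  have hact : ∀ (S : Type) [AddCommGroup S] [Module A S] [IsSimpleModule A S] (s : S),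
      e • s = x • s := by
    intro S _ _ _ s
    have := Module.mem_annihilator.mp (IsSemisimpleModule.jacobson_le_annihilator A S hex') s
    rwa [sub_smul, sub_eq_zero] at this
  exact ⟨e, he, fun S _ _ _ hS s => (hact S s).trans (hxF S hS s),
    fun S _ _ _ hS s => (hact S s).trans (hxT S hS s)⟩

theorem TorsionPair.idem_mul (P : TorsionPair A) (hP : P.IsBrickSplitting) (e : A)
    (he : IsIdempotentElem e)
    (hF : ∀ (S : Type) [AddCommGroup S] [Module A S] [IsSimpleModule A S],
        ModuleCat.of A S ∈ P.torsionFree → ∀ s : S, e • s = 0)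
    (hT : ∀ (S : Type) [AddCommGroup S] [Module A S] [IsSimpleModule A S],
        ModuleCat.of A S ∈ P.torsion → ∀ s : S, e • s = s) (a : A) : e * a * (1 - e) = 0 := by
  by_contra hne
  have hsplit : ∀ (S : Type) [AddCommGroup S] [Module A S] [IsSimpleModule A S],
      ModuleCat.of A S ∈ P.torsion ∨ ModuleCat.of A S ∈ P.torsionFree := fun S _ _ _ =>
    hP _ (inferInstanceAs (Module.Finite A S)) (isBrick_of_simple S)
  let 𝒮 : Set (Ideal A) := {I | e ∈ I ∧ ∃ b, e * b ∉ I}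
  have hne𝒮 : 𝒮.Nonempty := by
    refine ⟨Ideal.span {e}, Ideal.subset_span rfl, a, fun hmem => hne ?_⟩
    obtain ⟨c, hc⟩ := Ideal.mem_span_singleton'.mp hmem
    rw [← hc, mul_sub, mul_one, mul_assoc, he.eq, sub_self]
  obtain ⟨U, ⟨heU, b, hb⟩, hmax⟩ := WellFounded.has_min (wellFounded_gt (α := Ideal A)) 𝒮 hne𝒮
  have hmax' : ∀ V : Ideal A, U < V → ∀ b, e * b ∈ V := by
    intro V hV b
    by_contra hbV
    exact hmax V ⟨hV.le heU, b, hbV⟩ hV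
  -- every nonzero submodule of `A ⧸ U` contains `e (A ⧸ U)`
  have hsub : ∀ N : Submodule A (A ⧸ U), N ≠ ⊥ → ∀ y : A ⧸ U, e • y ∈ N := by
    intro N hN y
    obtain ⟨y, rfl⟩ := Submodule.Quotient.mk_surjective _ y
    have hlt : U < N.comap U.mkQ := by
      refine lt_of_le_of_ne ?_ ?_
      · intro u hu
        change U.mkQ u ∈ N
        rw [Submodule.mkQ_apply, (Submodule.Quotient.mk_eq_zero U).mpr hu]
        exact N.zero_mem
      · intro heq
        apply hN
        rw [eq_bot_iff]
        intro z hz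
        obtain ⟨z, rfl⟩ := Submodule.Quotient.mk_surjective _ z
        have : z ∈ N.comap U.mkQ := hz
        rw [← heq] at this
        exact (Submodule.Quotient.mk_eq_zero U).mpr this
    exact hmax' _ hlt y
  have hb0 : e • (Submodule.Quotient.mk b : A ⧸ U) ≠ 0 := by
    rw [← Submodule.Quotient.mk_smul, Ne, Submodule.Quotient.mk_eq_zero]
    exact hb
  have hnt : Nontrivial (A ⧸ U) := ⟨⟨_, _, hb0⟩⟩
  have hbrick : IsBrick A (ModuleCat.of A (A ⧸ U)) := by
    refine ⟨hnt, fun f hf => ?_⟩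
    change (A ⧸ U) →ₗ[A] (A ⧸ U) at f
    have hinj : Function.Injective f := by
      rw [← LinearMap.ker_eq_bot]
      by_contra hker
      have h1 : ∀ y, e • f y = 0 := fun y => by
        rw [← map_smul]; exact hsub _ hker y
      have hr : LinearMap.range f ≠ ⊥ := fun h => hf (LinearMap.range_eq_bot.mp h)
      obtain ⟨z, hz⟩ := hsub _ hr (Submodule.Quotient.mk b)
      apply hb0
      have h2 := h1 z
      rwa [hz, ← mul_smul, he.eq] at h2
    exact IsArtinian.bijective_of_injective_endomorphism f hinj
  rcases hP _ (inferInstanceAs (Module.Finite A (A ⧸ U))) hbrick with h | h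
  · -- `A ⧸ U` torsion: it has a simple torsion-free quotient
    obtain ⟨N, hN, -⟩ := (IsCoatomic.eq_top_or_exists_le_coatom
      (⊥ : Submodule A (A ⧸ U))).resolve_left bot_ne_top
    have hNs : IsSimpleModule A ((A ⧸ U) ⧸ N) := isSimpleModule_iff_isCoatom.mpr hN
    have hQT : ModuleCat.of A ((A ⧸ U) ⧸ N) ∈ P.torsion :=
      P.torsion_quot _ h (ModuleCat.of A ((A ⧸ U) ⧸ N)) N.mkQ N.mkQ_surjective
    have h1 := hT _ hQT (N.mkQ (Submodule.Quotient.mk (1 : A)))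
    rw [← map_smul, ← Submodule.Quotient.mk_smul, smul_eq_mul, mul_one,
      (Submodule.Quotient.mk_eq_zero U).mpr heU, map_zero] at h1
    apply hN.1
    rw [eq_top_iff]
    intro z _
    obtain ⟨z, rfl⟩ := Submodule.Quotient.mk_surjective _ z
    have h2 : N.mkQ (Submodule.Quotient.mk z) = z • N.mkQ (Submodule.Quotient.mk (1 : A)) := by
      rw [← map_smul, ← Submodule.Quotient.mk_smul, smul_eq_mul, mul_one]
    rw [← h1, smul_zero] at h2
    exact (Submodule.Quotient.mk_eq_zero N).mp h2
  · -- `A ⧸ U` torsion-free: it has a simple torsion submodule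
    obtain ⟨N, hN, -⟩ := (IsAtomic.eq_bot_or_exists_atom_le
      (⊤ : Submodule A (A ⧸ U))).resolve_left top_ne_bot
    have hNs : IsSimpleModule A N := isSimpleModule_iff_isAtom.mpr hN
    have hNF : ModuleCat.of A N ∈ P.torsionFree :=
      P.torsionFree_sub _ h (ModuleCat.of A N) N.subtype N.injective_subtype
    have hmem := hsub N hN.1 (Submodule.Quotient.mk b)
    have h1 := congrArg Subtype.val (hF N hNF ⟨_, hmem⟩)
    apply hb0
    have h2 : e • e • (Submodule.Quotient.mk b : A ⧸ U) = 0 := h1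
    rwa [← mul_smul, he.eq] at h2

theorem TorsionPair.trivial_of_idem (P : TorsionPair A) (hP : P.IsBrickSplitting) (e : A)
    (h01 : e = 0 ∨ e = 1)
    (hF : ∀ (S : Type) [AddCommGroup S] [Module A S] [IsSimpleModule A S],
        ModuleCat.of A S ∈ P.torsionFree → ∀ s : S, e • s = 0)
    (hT : ∀ (S : Type) [AddCommGroup S] [Module A S] [IsSimpleModule A S],
        ModuleCat.of A S ∈ P.torsion → ∀ s : S, e • s = s) : P.IsTrivial := by
  rcases h01 with rfl | rfl
  · left
    have key : ∀ M ∈ P.torsion, ¬ Nontrivial M := by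
      intro M hM hnt
      have := P.torsion_finite M hM
      obtain ⟨N, hN, -⟩ := (IsCoatomic.eq_top_or_exists_le_coatom
        (⊥ : Submodule A M)).resolve_left bot_ne_top
      have hNs : IsSimpleModule A (M ⧸ N) := isSimpleModule_iff_isCoatom.mpr hN
      have hQ : ModuleCat.of A (M ⧸ N) ∈ P.torsion :=
        P.torsion_quot _ hM (ModuleCat.of A (M ⧸ N)) N.mkQ N.mkQ_surjective
      have := IsSimpleModule.nontrivial A (M ⧸ N)
      obtain ⟨z, hz⟩ := exists_ne (0 : M ⧸ N)
      exact hz (by rw [← hT _ hQ z, zero_smul])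
    refine ⟨key, fun M hM => ?_⟩
    obtain ⟨t, ht, htF⟩ := P.exists_torsionSub M hM
    have h1 : ¬ Nontrivial t := key _ ht
    rw [Submodule.nontrivial_iff_ne_bot, not_not] at h1
    exact P.torsionFree_iso _ htF M (Submodule.quotEquivOfEqBot t h1)
  · right
    have key : ∀ M ∈ P.torsionFree, ¬ Nontrivial M := by
      intro M hM hnt
      have := P.torsionFree_finite M hM
      obtain ⟨N, hN, -⟩ := (IsAtomic.eq_bot_or_exists_atom_le
        (⊤ : Submodule A M)).resolve_left top_ne_bot
      have hNs : IsSimpleModule A N := isSimpleModule_iff_isAtom.mpr hN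
      have hQ : ModuleCat.of A N ∈ P.torsionFree :=
        P.torsionFree_sub _ hM (ModuleCat.of A N) N.subtype N.injective_subtype
      have := IsSimpleModule.nontrivial A N
      obtain ⟨z, hz⟩ := exists_ne (0 : N)
      exact hz (by rw [← hF _ hQ z, one_smul])
    refine ⟨fun M hM => ?_, key⟩
    obtain ⟨t, ht, htF⟩ := P.exists_torsionSub M hM
    have h1 : ¬ Nontrivial (M ⧸ t) := key _ htF
    rw [Submodule.Quotient.nontrivial_iff, not_not] at h1
    exact P.torsion_iso _ ht M (LinearEquiv.ofTop t h1)

end Torsion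

theorem stmt3 (k A : Type) [Field k] [Ring A] [Algebra k A] [FiniteDimensional k A] :
    (IsFullyCyclic A →
      ∀ P : TorsionPair A, P.IsBrickSplitting → P.IsTrivial) ∧
    (IsConnectedAlgebra A → Module.Injective A A →
      ∀ P : TorsionPair A, P.IsBrickSplitting → P.IsTrivial) := by
  have hart : IsArtinianRing A := IsArtinianRing.of_finite k A
  have hnoeth : IsNoetherianRing Aᵐᵒᵖ := IsNoetherianRing.of_finite k Aᵐᵒᵖ
  have main : ∀ P : TorsionPair A, P.IsBrickSplitting →
      (∀ e : A, IsIdempotentElem e → (∀ a : A, e * a * (1 - e) = 0) → e = 0 ∨ e = 1) →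
      P.IsTrivial := by
    intro P hP h
    obtain ⟨e, he, hF, hT⟩ := P.exists_idem hP
    exact P.trivial_of_idem hP e (h e he (P.idem_mul hP e he hF hT)) hF hT
  refine ⟨fun hc P hP => main P hP hc, fun hc hinj P hP => main P hP fun e he h0 => ?_⟩
  refine hc.2 e he fun a => ?_
  have h1 := selfinjective_idem hinj e he h0 a
  have h2 := h0 a
  rw [sub_mul, sub_mul, one_mul, sub_eq_zero] at h1
  rw [mul_sub, mul_one, sub_eq_zero] at h2
  exact h1.trans h2.symm
end

section
/- Let A and B be finite-dimensional algebras such that mod B is equivalent to a full subcategory of mod A. If A is brick-directed, then B is brick-directed. -/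
open Function

/-- `mod A` contains a brick-cycle: a sequence of nonzero non-invertible homomorphisms
`X₀ → X₁ → ⋯ → X_m` (`m ≥ 1`) between bricks with `X₀ ≅ X_m`. -/
def HasBrickCycle (A : Type) [Ring A] : Prop :=
  ∃ (m : ℕ) (X : ℕ → ModuleCat.{0} A) (f : ∀ i : ℕ, X i →ₗ[A] X (i + 1)),
    1 ≤ m ∧ (∀ i ≤ m, Module.Finite A (X i) ∧ IsBrick A (X i)) ∧
    (∀ i < m, f i ≠ 0 ∧ ¬ Function.Bijective (f i)) ∧
    Nonempty (X 0 ≃ₗ[A] X m)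

/-- `A` is brick-directed if `mod A` contains no brick-cycle. -/
def BrickDirected (A : Type) [Ring A] : Prop := ¬ HasBrickCycle A

/-- If `mod B` is equivalent to a full subcategory of `mod A` (here witnessed by a
fully faithful additive functor from `mod B` to `mod A`, given by its action on
objects and on Hom-groups) and `A` is brick-directed, then `B` is brick-directed. -/
theorem stmt7 (k A B : Type) [Field k]
    [Ring A] [Algebra k A] [FiniteDimensional k A]
    [Ring B] [Algebra k B] [FiniteDimensional k B]
    (obj : ∀ M : ModuleCat.{0} B, Module.Finite B M → ModuleCat.{0} A)
    (hobj : ∀ (M : ModuleCat.{0} B) (hM : Module.Finite B M), Module.Finite A (obj M hM))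
    (map : ∀ (M N : ModuleCat.{0} B) (hM : Module.Finite B M) (hN : Module.Finite B N),
      (M →ₗ[B] N) → ((obj M hM) →ₗ[A] (obj N hN)))
    (hid : ∀ (M : ModuleCat.{0} B) (hM : Module.Finite B M),
      map M M hM hM LinearMap.id = LinearMap.id)
    (hcomp : ∀ (M N P : ModuleCat.{0} B) (hM : Module.Finite B M) (hN : Module.Finite B N)
      (hP : Module.Finite B P) (f : M →ₗ[B] N) (g : N →ₗ[B] P),
      map M P hM hP (g ∘ₗ f) = (map N P hN hP g) ∘ₗ (map M N hM hN f))
    (hadd : ∀ (M N : ModuleCat.{0} B) (hM : Module.Finite B M) (hN : Module.Finite B N)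
      (f g : M →ₗ[B] N), map M N hM hN (f + g) = map M N hM hN f + map M N hM hN g)
    -- fully faithful: bijective on Hom-groups
    (hbij : ∀ (M N : ModuleCat.{0} B) (hM : Module.Finite B M) (hN : Module.Finite B N),
      Function.Bijective (map M N hM hN))
    (hA : BrickDirected A) : BrickDirected B := by
  have hzero : ∀ (M N : ModuleCat.{0} B) (hM : Module.Finite B M) (hN : Module.Finite B N),
      map M N hM hN 0 = 0 := by
    intro M N hM hN
    have h := hadd M N hM hN 0 0
    rw [add_zero] at h
    exact left_eq_add.mp h
  have hfwd : ∀ (M N : ModuleCat.{0} B) (hM : Module.Finite B M) (hN : Module.Finite B N)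
      (e : M ≃ₗ[B] N), Nonempty (obj M hM ≃ₗ[A] obj N hN) ∧
        Function.Bijective (map M N hM hN e.toLinearMap) := by
    intro M N hM hN e
    have h1 : (map M N hM hN e.toLinearMap) ∘ₗ (map N M hN hM e.symm.toLinearMap)
        = LinearMap.id := by
      rw [← hcomp, ← hid]; congr 1; ext x; simp
    have h2 : (map N M hN hM e.symm.toLinearMap) ∘ₗ (map M N hM hN e.toLinearMap)
        = LinearMap.id := by
      rw [← hcomp, ← hid]; congr 1; ext x; simp
    let E : obj M hM ≃ₗ[A] obj N hN := LinearEquiv.ofLinearMap _ _ h1 h2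
    exact ⟨⟨E⟩, E.bijective⟩
  have hbwd : ∀ (M N : ModuleCat.{0} B) (hM : Module.Finite B M) (hN : Module.Finite B N)
      (f : M →ₗ[B] N), Function.Bijective (map M N hM hN f) → Function.Bijective f := by
    intro M N hM hN f hf
    let E : obj M hM ≃ₗ[A] obj N hN := LinearEquiv.ofBijective _ hf
    obtain ⟨g, hg⟩ := (hbij N M hN hM).2 E.symm.toLinearMap
    have h1 : f ∘ₗ g = LinearMap.id := by
      apply (hbij N N hN hN).1
      rw [hcomp N M N hN hM hN, hid, hg]
      ext x
      exact E.apply_symm_apply x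
    have h2 : g ∘ₗ f = LinearMap.id := by
      apply (hbij M M hM hM).1
      rw [hcomp M N M hM hN hM, hid, hg]
      ext x
      exact E.symm_apply_apply x
    exact (LinearEquiv.ofLinearMap f g h1 h2 : M ≃ₗ[B] N).bijective
  have hbrick : ∀ (M : ModuleCat.{0} B) (hM : Module.Finite B M), IsBrick B M →
      IsBrick A (obj M hM) := by
    rintro M hM ⟨hn, hb⟩
    refine ⟨?_, ?_⟩
    · by_contra hc
      rw [not_nontrivial_iff_subsingleton] at hc
      have h0 : (LinearMap.id : M →ₗ[B] M) = 0 := by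
        apply (hbij M M hM hM).1
        ext x
        exact Subsingleton.elim _ _
      obtain ⟨x, hx⟩ := exists_ne (0 : M)
      exact hx (LinearMap.congr_fun h0 x)
    · intro f hf
      obtain ⟨g, rfl⟩ := (hbij M M hM hM).2 f
      have hg : g ≠ 0 := by
        rintro rfl
        exact hf (hzero _ _ _ _)
      exact (hfwd M M hM hM (LinearEquiv.ofBijective g (hb g hg))).2
  rintro ⟨m, X, f, hm, hX, hf, ⟨e⟩⟩
  apply hA
  classical
  let Y : ℕ → ModuleCat.{0} A := fun i =>
    if h : Module.Finite B (X i) then obj (X i) h else ModuleCat.of A PUnit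
  have hY : ∀ i (h : Module.Finite B (X i)), Y i = obj (X i) h := fun i h => dif_pos h
  have hg : ∀ i, ∃ g : Y i →ₗ[A] Y (i + 1), i < m → g ≠ 0 ∧ ¬ Function.Bijective g := by
    intro i
    by_cases hi : i < m
    · have h1 := (hX i hi.le).1
      have h2 := (hX (i + 1) hi).1
      rw [hY i h1, hY (i + 1) h2]
      refine ⟨map _ _ h1 h2 (f i), fun _ => ⟨fun h => (hf i hi).1 ?_, fun h => (hf i hi).2 ?_⟩⟩
      · exact (hbij _ _ h1 h2).1 (h.trans (hzero _ _ _ _).symm)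
      · exact hbwd _ _ _ _ _ h
    · exact ⟨0, fun h => absurd h hi⟩
  choose g hg using hg
  refine ⟨m, Y, g, hm, ?_, hg, ?_⟩
  · intro i hi
    rw [hY i (hX i hi).1]
    exact ⟨hobj _ _, hbrick _ _ (hX i hi).2⟩
  · rw [hY 0 (hX 0 (Nat.zero_le _)).1, hY m (hX m le_rfl).1]
    exact (hfwd _ _ _ _ e).1
end

section
/- A strictly wild finite-dimensional algebra is never brick-directed; that is, if there exists a fully faithful exact k-linear functor from mod k⟨x,y⟩ (finite-dimensional modules over the free algebra on two generators) to mod A, then mod A contains a brick-cycle. -/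
open Function

/-- Scalar multiplication by `c : k` on Hom-groups of modules over a `k`-algebra `R`
(`k` acts through the central image of `algebraMap k R`). -/
def homSMul (k : Type) [CommSemiring k] {R : Type} [Ring R] [Algebra k R]
    {M N : Type} [AddCommGroup M] [AddCommGroup N] [Module R M] [Module R N]
    (c : k) (f : M →ₗ[R] N) : M →ₗ[R] N where
  toFun := fun m => algebraMap k R c • f m
  map_add' := by intro x y; simp [smul_add]
  map_smul' := by
    intro r x
    simp only [map_smul, RingHom.id_apply, smul_smul]
    rw [Algebra.commutes]

/-- `M` is a finite-dimensional module over the `k`-algebra `R`. -/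
def FinDimOver (k : Type) [Field k] (R : Type) [Ring R] [Algebra k R]
    (M : ModuleCat.{0} R) : Prop :=
  Module.Finite k (RestrictScalars k R M)

/-- The underlying space `k × k` of the representation of the free algebra in which the two
generators act by `x` and `y`. -/
def FreeRep {k : Type} [Field k] (_x _y : Module.End k (k × k)) : Type := k × k

namespace FreeRep

variable {k : Type} [Field k] (x y : Module.End k (k × k))

instance : AddCommGroup (FreeRep x y) := inferInstanceAs (AddCommGroup (k × k))

/-- The structure morphism. -/
noncomputable def act : FreeAlgebra k (Fin 2) →ₐ[k] Module.End k (k × k) :=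
  FreeAlgebra.lift k ![x, y]

noncomputable instance : Module (FreeAlgebra k (Fin 2)) (FreeRep x y) :=
  Module.compHom (k × k) (act x y).toRingHom

/-- The bundled module. -/
noncomputable def mk : ModuleCat.{0} (FreeAlgebra k (Fin 2)) := ModuleCat.of _ (FreeRep x y)

theorem smul_def (r : FreeAlgebra k (Fin 2)) (v : FreeRep x y) : r • v = act x y r v := rfl

theorem smul_x (v : FreeRep x y) : (FreeAlgebra.ι k (0 : Fin 2)) • v = x v := by
  rw [smul_def, act, FreeAlgebra.lift_ι_apply]; rfl

theorem smul_y (v : FreeRep x y) : (FreeAlgebra.ι k (1 : Fin 2)) • v = y v := by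
  rw [smul_def, act, FreeAlgebra.lift_ι_apply]; rfl

theorem smul_c (c : k) (v : FreeRep x y) :
    (algebraMap k (FreeAlgebra k (Fin 2)) c) • v = (show k × k from c • (show k × k from v)) := by
  rw [smul_def, AlgHom.commutes]; rfl

theorem finDim : FinDimOver k (FreeAlgebra k (Fin 2)) (mk x y) := by
  let e : (k × k) →ₗ[k] RestrictScalars k (FreeAlgebra k (Fin 2)) (mk x y) :=
    { toFun := fun v => (show FreeRep x y from v)
      map_add' := fun _ _ => rfl
      map_smul' := fun c v => (smul_c x y c v).symm }
  exact Module.Finite.of_surjective e (fun v => ⟨v, rfl⟩)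

variable {x y}

theorem act_comm {x₂ y₂ : Module.End k (k × k)} (f : Module.End k (k × k))
    (hx : ∀ v, f (x v) = x₂ (f v)) (hy : ∀ v, f (y v) = y₂ (f v))
    (r : FreeAlgebra k (Fin 2)) (v : k × k) : f (act x y r v) = act x₂ y₂ r (f v) := by
  induction r using FreeAlgebra.induction generalizing v with
  | grade0 c => simp [AlgHom.commutes, Module.algebraMap_end_apply]
  | grade1 i =>
    rw [act, act, FreeAlgebra.lift_ι_apply, FreeAlgebra.lift_ι_apply]
    fin_cases i
    · exact hx v
    · exact hy v
  | mul a b ha hb => rw [map_mul, map_mul, Module.End.mul_apply, Module.End.mul_apply, ha, hb]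
  | add a b ha hb => rw [map_add, map_add, LinearMap.add_apply, LinearMap.add_apply, map_add, ha, hb]

/-- A linear map intertwining the generators. -/
noncomputable def hom {x₂ y₂ : Module.End k (k × k)} (f : Module.End k (k × k))
    (hx : ∀ v, f (x v) = x₂ (f v)) (hy : ∀ v, f (y v) = y₂ (f v)) :
    FreeRep x y →ₗ[FreeAlgebra k (Fin 2)] FreeRep x₂ y₂ where
  toFun v := f v
  map_add' := f.map_add
  map_smul' r v := act_comm f hx hy r v

/-- Any homomorphism of representations gives a linear map intertwining the generators. -/
theorem exists_lin (g : FreeRep x y →ₗ[FreeAlgebra k (Fin 2)] FreeRep x y) :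
    ∃ f : Module.End k (k × k), (∀ v, f (x v) = x (f v)) ∧ (∀ v, f (y v) = y (f v)) ∧
      ∀ v, g v = f v := by
  refine ⟨{ toFun := fun v => g v
            map_add' := fun a b => g.map_add a b
            map_smul' := fun c v => ?_ }, fun v => ?_, fun v => ?_, fun v => rfl⟩
  · exact ((congrArg g (smul_c x y c v)).symm.trans
      (g.map_smul (algebraMap k (FreeAlgebra k (Fin 2)) c) v)).trans (smul_c x y c (g v))
  · exact ((congrArg g (smul_x x y v)).symm.trans
      (g.map_smul (FreeAlgebra.ι k (0 : Fin 2)) v)).trans (smul_x x y (g v))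
  · exact ((congrArg g (smul_y x y v)).symm.trans
      (g.map_smul (FreeAlgebra.ι k (1 : Fin 2)) v)).trans (smul_y x y (g v))

/-- If all intertwiners are scalars, every nonzero endomorphism is bijective. -/
theorem bij_of_scalar
    (H : ∀ f : Module.End k (k × k), (∀ v, f (x v) = x (f v)) → (∀ v, f (y v) = y (f v)) →
      ∃ c : k, ∀ v, f v = c • v)
    (g : FreeRep x y →ₗ[FreeAlgebra k (Fin 2)] FreeRep x y) (hg : g ≠ 0) : Function.Bijective g := by
  obtain ⟨f, hx, hy, hf⟩ := exists_lin g
  obtain ⟨c, hc⟩ := H f hx hy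
  have hc0 : c ≠ 0 := by
    rintro rfl
    apply hg
    exact LinearMap.ext fun v => (hf v).trans ((hc v).trans (zero_smul k (A := k × k) v))
  have hb : Function.Bijective (fun v : k × k => c • v) :=
    MulAction.bijective (Units.mk0 c hc0)
  have hgc : ∀ v, g v = (fun v : k × k => c • v) v := fun v => (hf v).trans (hc v)
  exact ⟨fun v w h => hb.1 ((hgc v).symm.trans (h.trans (hgc w))),
    fun w => (hb.2 w).imp fun v h => (hgc v).trans h⟩

end FreeRep

section
variable (k : Type) [Field k]

/-- `diag(0,1)` -/
def opD : Module.End k (k × k) := (LinearMap.inr k k k) ∘ₗ (LinearMap.snd k k k)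
/-- `diag(1,0)` -/
def opE : Module.End k (k × k) := (LinearMap.inl k k k) ∘ₗ (LinearMap.fst k k k)
/-- upper nilpotent -/
def opU : Module.End k (k × k) := (LinearMap.inl k k k) ∘ₗ (LinearMap.snd k k k)
/-- lower nilpotent -/
def opL : Module.End k (k × k) := (LinearMap.inr k k k) ∘ₗ (LinearMap.fst k k k)

theorem scalar_U (f : Module.End k (k × k)) (hx : ∀ v, f (opD k v) = opD k (f v))
    (hy : ∀ v, f (opU k v) = opU k (f v)) : ∃ c : k, ∀ v, f v = c • v := by
  have h0 : f (0, 0) = 0 := map_zero f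
  have h1 := hx (1, 0)
  have h2 := hx (0, 1)
  have h3 := hy (0, 1)
  simp [opD, opU, h0, Prod.ext_iff] at h1 h2 h3
  refine ⟨(f (1, 0)).1, fun v => ?_⟩
  have hv : v = v.1 • ((1, 0) : k × k) + v.2 • ((0, 1) : k × k) := by ext <;> simp
  have : f v = v.1 • f (1, 0) + v.2 • f (0, 1) := by
    conv_lhs => rw [hv]
    rw [map_add, map_smul, map_smul]
  rw [this]
  clear hx hy this hv
  ext
  · simp; grind
  · simp; grind

theorem scalar_L (f : Module.End k (k × k)) (hx : ∀ v, f (opD k v) = opD k (f v))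
    (hy : ∀ v, f (opL k v) = opL k (f v)) : ∃ c : k, ∀ v, f v = c • v := by
  have h0 : f (0, 0) = 0 := map_zero f
  have h1 := hx (1, 0)
  have h2 := hx (0, 1)
  have h3 := hy (1, 0)
  simp [opD, opL, h0, Prod.ext_iff] at h1 h2 h3
  refine ⟨(f (1, 0)).1, fun v => ?_⟩
  have hv : v = v.1 • ((1, 0) : k × k) + v.2 • ((0, 1) : k × k) := by ext <;> simp
  have : f v = v.1 • f (1, 0) + v.2 • f (0, 1) := by
    conv_lhs => rw [hv]
    rw [map_add, map_smul, map_smul]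
  rw [this]
  clear hx hy this hv
  ext
  · simp; grind
  · simp; grind

/-- The map `X → Y`. -/
noncomputable def mapXY : FreeRep.mk (opD k) (opU k) →ₗ[FreeAlgebra k (Fin 2)] FreeRep.mk (opD k) (opL k) :=
  FreeRep.hom (opD k) (fun v => rfl) (fun v => by simp [opD, opU, opL])

/-- The map `Y → X`. -/
noncomputable def mapYX : FreeRep.mk (opD k) (opL k) →ₗ[FreeAlgebra k (Fin 2)] FreeRep.mk (opD k) (opU k) :=
  FreeRep.hom (opE k) (fun v => by simp [opD, opE]) (fun v => by simp [opE, opU, opL])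

theorem mapXY_ne : mapXY k ≠ 0 := by
  intro h
  have h1 : opD k (0, 1) = (0 : k × k) := DFunLike.congr_fun h (show k × k from (0, 1))
  simp [opD] at h1

theorem mapYX_ne : mapYX k ≠ 0 := by
  intro h
  have h1 : opE k (1, 0) = (0 : k × k) := DFunLike.congr_fun h (show k × k from (1, 0))
  simp [opE] at h1

theorem mapXY_inj : ¬ Function.Injective (mapXY k) := by
  intro h
  have h1 : ((1, 0) : k × k) = (0, 0) := @h (show k × k from (1, 0)) (show k × k from (0, 0)) (by
    change opD k (1, 0) = opD k (0, 0)
    simp [opD])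
  simp at h1

theorem mapYX_inj : ¬ Function.Injective (mapYX k) := by
  intro h
  have h1 : ((0, 1) : k × k) = (0, 0) := @h (show k × k from (0, 1)) (show k × k from (0, 0)) (by
    change opE k (0, 1) = opE k (0, 0)
    simp [opE])
  simp at h1

end

/-- A two-step cycle of bricks. -/
theorem hasBrickCycle_of_two {A : Type} [Ring A] (P Q : ModuleCat.{0} A)
    (hP : Module.Finite A P ∧ IsBrick A P) (hQ : Module.Finite A Q ∧ IsBrick A Q)
    (f : P →ₗ[A] Q) (g : Q →ₗ[A] P) (hf : f ≠ 0 ∧ ¬ Function.Bijective f)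
    (hg : g ≠ 0 ∧ ¬ Function.Bijective g) : HasBrickCycle A := by
  let X : ℕ → ModuleCat.{0} A := fun n => match n with
    | 0 => P
    | 1 => Q
    | _ + 2 => P
  let F : ∀ i : ℕ, X i →ₗ[A] X (i + 1) := fun n => match n with
    | 0 => f
    | 1 => g
    | _ + 2 => (0 : P →ₗ[A] P)
  refine ⟨2, X, F, by norm_num, ?_, ?_, ⟨LinearEquiv.refl A P⟩⟩
  · intro i hi
    match i with
    | 0 => exact hP
    | 1 => exact hQ
    | _ + 2 => exact hP
  · intro i hi
    match i with
    | 0 => exact hf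
    | 1 => exact hg
    | n + 2 => omega

/-- A strictly wild algebra is never brick-directed: if there is a fully faithful exact
`k`-linear functor from `mod k⟨x,y⟩` (finite-dimensional modules over the free algebra
on two generators) to `mod A`, then `mod A` contains a brick-cycle. -/
theorem stmt9 (k A : Type) [Field k] [Ring A] [Algebra k A] [FiniteDimensional k A]
    (obj : ∀ M : ModuleCat.{0} (FreeAlgebra k (Fin 2)),
      FinDimOver k (FreeAlgebra k (Fin 2)) M → ModuleCat.{0} A)
    (hobj : ∀ (M : ModuleCat.{0} (FreeAlgebra k (Fin 2)))
      (hM : FinDimOver k (FreeAlgebra k (Fin 2)) M), Module.Finite A (obj M hM))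
    (map : ∀ (M N : ModuleCat.{0} (FreeAlgebra k (Fin 2)))
      (hM : FinDimOver k (FreeAlgebra k (Fin 2)) M)
      (hN : FinDimOver k (FreeAlgebra k (Fin 2)) N),
      (M →ₗ[FreeAlgebra k (Fin 2)] N) → ((obj M hM) →ₗ[A] (obj N hN)))
    (hid : ∀ (M : ModuleCat.{0} (FreeAlgebra k (Fin 2)))
      (hM : FinDimOver k (FreeAlgebra k (Fin 2)) M),
      map M M hM hM LinearMap.id = LinearMap.id)
    (hcomp : ∀ (M N P : ModuleCat.{0} (FreeAlgebra k (Fin 2)))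
      (hM : FinDimOver k (FreeAlgebra k (Fin 2)) M)
      (hN : FinDimOver k (FreeAlgebra k (Fin 2)) N)
      (hP : FinDimOver k (FreeAlgebra k (Fin 2)) P)
      (f : M →ₗ[FreeAlgebra k (Fin 2)] N) (g : N →ₗ[FreeAlgebra k (Fin 2)] P),
      map M P hM hP (g ∘ₗ f) = (map N P hN hP g) ∘ₗ (map M N hM hN f))
    -- `k`-linearity on Hom-groups
    (hadd : ∀ (M N : ModuleCat.{0} (FreeAlgebra k (Fin 2)))
      (hM : FinDimOver k (FreeAlgebra k (Fin 2)) M)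
      (hN : FinDimOver k (FreeAlgebra k (Fin 2)) N)
      (f g : M →ₗ[FreeAlgebra k (Fin 2)] N),
      map M N hM hN (f + g) = map M N hM hN f + map M N hM hN g)
    (hsmul : ∀ (M N : ModuleCat.{0} (FreeAlgebra k (Fin 2)))
      (hM : FinDimOver k (FreeAlgebra k (Fin 2)) M)
      (hN : FinDimOver k (FreeAlgebra k (Fin 2)) N)
      (c : k) (f : M →ₗ[FreeAlgebra k (Fin 2)] N),
      map M N hM hN (homSMul k c f) = homSMul k c (map M N hM hN f))
    -- fully faithful
    (hbij : ∀ (M N : ModuleCat.{0} (FreeAlgebra k (Fin 2)))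
      (hM : FinDimOver k (FreeAlgebra k (Fin 2)) M)
      (hN : FinDimOver k (FreeAlgebra k (Fin 2)) N),
      Function.Bijective (map M N hM hN))
    -- exact
    (hexact : ∀ (M N P : ModuleCat.{0} (FreeAlgebra k (Fin 2)))
      (hM : FinDimOver k (FreeAlgebra k (Fin 2)) M)
      (hN : FinDimOver k (FreeAlgebra k (Fin 2)) N)
      (hP : FinDimOver k (FreeAlgebra k (Fin 2)) P)
      (f : M →ₗ[FreeAlgebra k (Fin 2)] N) (g : N →ₗ[FreeAlgebra k (Fin 2)] P),
      Function.Injective f → Function.Surjective g → Function.Exact f g →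
      Function.Injective (map M N hM hN f) ∧ Function.Surjective (map N P hN hP g) ∧
        Function.Exact (map M N hM hN f) (map N P hN hP g)) :
    HasBrickCycle A := by
  have hzero : ∀ M N hM hN, map M N hM hN 0 = 0 := by
    intro M N hM hN
    have := hadd M N hM hN 0 0
    rw [add_zero] at this
    exact left_eq_add.mp this
  have hne : ∀ M N hM hN f, f ≠ 0 → map M N hM hN f ≠ 0 := by
    intro M N hM hN f hf h
    exact hf ((hbij M N hM hN).1 (h.trans (hzero M N hM hN).symm))
  have hnb : ∀ (M N : ModuleCat.{0} (FreeAlgebra k (Fin 2))) hM hN (f : M →ₗ[FreeAlgebra k (Fin 2)] N), ¬ Function.Injective f →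
      ¬ Function.Bijective (map M N hM hN f) := by
    intro M N hM hN f hf hb
    obtain ⟨h, hh⟩ := (hbij N M hN hM).2 (LinearEquiv.ofBijective _ hb).symm.toLinearMap
    have h1 : h ∘ₗ f = LinearMap.id := by
      apply (hbij M M hM hM).1
      rw [hcomp M N M hM hN hM, hh, hid]
      ext v
      exact (LinearEquiv.ofBijective _ hb).symm_apply_apply v
    apply hf
    exact Function.LeftInverse.injective (g := h) (fun v => DFunLike.congr_fun h1 v)
  have hbrick : ∀ M hM, IsBrick _ M → IsBrick A (obj M hM) := by
    intro M hM hB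
    refine ⟨?_, ?_⟩
    · by_contra hn
      rw [not_nontrivial_iff_subsingleton] at hn
      have := hB.1
      have h1 : (LinearMap.id : M →ₗ[FreeAlgebra k (Fin 2)] M) ≠ 0 := by
        intro h
        obtain ⟨v, hv⟩ := exists_ne (0 : M)
        exact hv (DFunLike.congr_fun h v)
      exact hne M M hM hM _ h1 (LinearMap.ext fun v => Subsingleton.elim _ _)
    · intro φ hφ
      obtain ⟨f, rfl⟩ := (hbij M M hM hM).2 φ
      have hf : f ≠ 0 := by
        rintro rfl
        exact hφ (hzero M M hM hM)
      let e := LinearEquiv.ofBijective f (hB.2 f hf)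
      have h1 : e.symm.toLinearMap ∘ₗ f = LinearMap.id :=
        LinearMap.ext fun v => e.symm_apply_apply v
      have h2 : f ∘ₗ e.symm.toLinearMap = LinearMap.id :=
        LinearMap.ext fun v => e.apply_symm_apply v
      have h1c := hcomp M M M hM hM hM f e.symm.toLinearMap
      have h2c := hcomp M M M hM hM hM e.symm.toLinearMap f
      rw [h1, hid] at h1c
      rw [h2, hid] at h2c
      exact Function.bijective_iff_has_inverse.mpr ⟨map M M hM hM e.symm.toLinearMap,
        fun v => (DFunLike.congr_fun h1c v).symm, fun v => (DFunLike.congr_fun h2c v).symm⟩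
  have hX := FreeRep.finDim (opD k) (opU k)
  have hY := FreeRep.finDim (opD k) (opL k)
  have bX : IsBrick _ (FreeRep.mk (opD k) (opU k)) :=
    ⟨inferInstanceAs (Nontrivial (k × k)), FreeRep.bij_of_scalar (scalar_U k)⟩
  have bY : IsBrick _ (FreeRep.mk (opD k) (opL k)) :=
    ⟨inferInstanceAs (Nontrivial (k × k)), FreeRep.bij_of_scalar (scalar_L k)⟩
  exact hasBrickCycle_of_two (obj _ hX) (obj _ hY) ⟨hobj _ hX, hbrick _ hX bX⟩
    ⟨hobj _ hY, hbrick _ hY bY⟩ (map _ _ hX hY (mapXY k)) (map _ _ hY hX (mapYX k))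
    ⟨hne _ _ hX hY _ (mapXY_ne k), hnb _ _ hX hY _ (mapXY_inj k)⟩
    ⟨hne _ _ hY hX _ (mapYX_ne k), hnb _ _ hY hX _ (mapYX_inj k)⟩
end
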